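/- arXiv:math/0409202 — 2 statements merged into one kernel-verified Lean document; each statement's English description precedes it below -/
import Mathlib

section
/- Let Q be a rack such that Inn(Q) is finite and its order |Inn(Q)| is a unit in the commutative ring A, and let m ⊆ A be an ideal with m^{n+1} = 0 for some n ≥ 1. Let c be a Yang-Baxter operator on AQ² of the form c = c_Q ∘ f, where f is an automorphism of AQ² with f ≡ id mod m and f is entropic modulo m^n, i.e., f^{u,v}_{x,y} ∈ m^n whenever u ≢ x or v ≢ y, and f^{u,v}_{x,y} − f^{u^{α},v^{β}}_{x^{α},y^{β}} ∈ m^n for all u,v,x,y ∈ Q and all α,β ∈ Inn(Q). Then there exists an A-linear automorphism α of AQ with α ≡ id mod m^n such that (α ⊗ α)^{−1} c (α ⊗ α) = c_Q ∘ f′ for some entropic automorphism f′ of AQ² with f′ ≡ id mod m. -/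
open TensorProduct

noncomputable section

/-- A rack: a set with a binary operation `act x y = x ^ y` such that all right
translations are bijective and the operation is right self-distributive. -/
structure YBRack (Q : Type*) where
  act : Q → Q → Q
  act_bijective : ∀ y : Q, Function.Bijective fun x => act x y
  self_distrib : ∀ x y z : Q, act (act x y) z = act (act x z) (act y z)

namespace YBRack

variable {Q : Type*} {A : Type*} [CommRing A]

/-- Right translation by `y` as a permutation of `Q`. -/
def rho (R : YBRack Q) (y : Q) : Equiv.Perm Q :=
  Equiv.ofBijective _ (R.act_bijective y)

/-- The inner automorphism group of a rack: the subgroup of `Perm Q` generated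
by all right translations. -/
def Inn (R : YBRack Q) : Subgroup (Equiv.Perm Q) :=
  Subgroup.closure (Set.range R.rho)

/-- Behavioural equivalence: `x ≡ y` iff `ϱ(x) = ϱ(y)`. -/
def BEquiv (R : YBRack Q) (x y : Q) : Prop := R.rho x = R.rho y

end YBRack
/-- Matrix of a linear endomorphism of `AQ ⊗ AQ`, via the identification of
`AQ ⊗ AQ` with the free module on `Q × Q`. -/
def mat2 (A : Type*) [CommRing A] {Q : Type*}
    (f : ((Q →₀ A) ⊗[A] (Q →₀ A)) →ₗ[A] ((Q →₀ A) ⊗[A] (Q →₀ A))) (p q : Q × Q) : A :=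
  finsuppTensorFinsupp' A Q Q (f ((finsuppTensorFinsupp' A Q Q).symm (Finsupp.single p 1))) q

/-- Matrix of a linear endomorphism of `AQ`. -/
def mat1 (A : Type*) [CommRing A] {Q : Type*}
    (f : (Q →₀ A) →ₗ[A] (Q →₀ A)) (x u : Q) : A :=
  f (Finsupp.single x 1) u

/-- The Yang–Baxter (braid) equation for an endomorphism of `M ⊗ M`, where
`c₁ = c ⊗ id` and `c₂ = id ⊗ c` act on `(M ⊗ M) ⊗ M`. -/
def YBE {A M : Type*} [CommRing A] [AddCommGroup M] [Module A M]
    (c : (M ⊗[A] M) →ₗ[A] (M ⊗[A] M)) : Prop :=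
  (LinearMap.rTensor M c) ∘ₗ
      ((TensorProduct.assoc A M M M).symm.toLinearMap ∘ₗ (LinearMap.lTensor M c) ∘ₗ
        (TensorProduct.assoc A M M M).toLinearMap) ∘ₗ (LinearMap.rTensor M c)
    = ((TensorProduct.assoc A M M M).symm.toLinearMap ∘ₗ (LinearMap.lTensor M c) ∘ₗ
        (TensorProduct.assoc A M M M).toLinearMap) ∘ₗ (LinearMap.rTensor M c) ∘ₗ
      ((TensorProduct.assoc A M M M).symm.toLinearMap ∘ₗ (LinearMap.lTensor M c) ∘ₗ
        (TensorProduct.assoc A M M M).toLinearMap)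

/-- A Yang–Baxter operator: a bijective linear endomorphism of `M ⊗ M`
satisfying the Yang–Baxter equation. -/
def IsYBOp {A M : Type*} [CommRing A] [AddCommGroup M] [Module A M]
    (c : (M ⊗[A] M) →ₗ[A] (M ⊗[A] M)) : Prop :=
  Function.Bijective c ∧ YBE c

/-- An endomorphism of `AQ ⊗ AQ` is entropic (with respect to the rack `R`)
if its matrix is quasi-diagonal and fully equivariant. -/
def Entropic2 {Q : Type*} (R : YBRack Q) (A : Type*) [CommRing A]
    (f : ((Q →₀ A) ⊗[A] (Q →₀ A)) →ₗ[A] ((Q →₀ A) ⊗[A] (Q →₀ A))) : Prop :=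
  (∀ x y u v : Q, (¬ R.BEquiv x u ∨ ¬ R.BEquiv y v) → mat2 A f (x, y) (u, v) = 0) ∧
  (∀ (x y u v : Q) (α β : R.Inn),
    mat2 A f ((α : Equiv.Perm Q) x, (β : Equiv.Perm Q) y)
        ((α : Equiv.Perm Q) u, (β : Equiv.Perm Q) v)
      = mat2 A f (x, y) (u, v))

open scoped Classical in
/-- Two Yang–Baxter operators are equivalent with respect to the ideal `m` if
they are conjugate by `α ⊗ α` for some automorphism `α` of `AQ` congruent to
the identity modulo `m`. -/
def YBEquivalent {Q A : Type*} [CommRing A] (m : Ideal A)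
    (c c' : ((Q →₀ A) ⊗[A] (Q →₀ A)) →ₗ[A] ((Q →₀ A) ⊗[A] (Q →₀ A))) : Prop :=
  ∃ α : (Q →₀ A) ≃ₗ[A] (Q →₀ A),
    (∀ x u : Q, (α (Finsupp.single x 1)) u - (if x = u then 1 else 0) ∈ m) ∧
    c' = (TensorProduct.congr α α).toLinearMap ∘ₗ c ∘ₗ (TensorProduct.congr α α).symm.toLinearMap


namespace YBRack

variable {Q : Type*} {A : Type*} [CommRing A] (R : YBRack Q)

lemma rho_apply (x y : Q) : R.rho y x = R.act x y := rfl

lemma act_left_inj {x x' y : Q} : R.act x y = R.act x' y ↔ x = x' :=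
  (R.act_bijective y).1.eq_iff

lemma rho_mem (y : Q) : R.rho y ∈ R.Inn := Subgroup.subset_closure ⟨y, rfl⟩

/-- The right translation by `y` as an inner automorphism. -/
def inn (y : Q) : R.Inn := ⟨R.rho y, R.rho_mem y⟩

lemma coe_inn_apply (x y : Q) : (R.inn y : Equiv.Perm Q) x = R.act x y := rfl

lemma BEquiv.act_eq {R : YBRack Q} {x y : Q} (h : R.BEquiv x y) (z : Q) :
    R.act z x = R.act z y := by
  rw [← rho_apply, ← rho_apply, h]

lemma exists_act_ne {y q : Q} (h : ¬ R.BEquiv y q) : ∃ x, R.act x y ≠ R.act x q := by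
  by_contra! H
  exact h (Equiv.ext H)

lemma inn_act (α : R.Inn) : ∀ x y : Q, (α : Equiv.Perm Q) (R.act x y) =
    R.act ((α : Equiv.Perm Q) x) ((α : Equiv.Perm Q) y) := by
  obtain ⟨α, hα⟩ := α
  induction hα using Subgroup.closure_induction with
  | mem a ha =>
    obtain ⟨z, rfl⟩ := ha
    exact fun x y => R.self_distrib x y z
  | one => intro x y; rfl
  | mul a b _ _ iha ihb =>
    intro x y
    simp only [Equiv.Perm.mul_apply] at *
    rw [ihb, iha]
  | inv a _ ih =>
    intro x y
    simp only at *
    apply a.injective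
    simp [ih]

lemma rho_inn (α : R.Inn) (y : Q) :
    R.rho ((α : Equiv.Perm Q) y) = (α : Equiv.Perm Q) * R.rho y * (α : Equiv.Perm Q)⁻¹ := by
  ext x
  simp only [rho_apply, Equiv.Perm.mul_apply, inn_act, Equiv.Perm.coe_inv,
    Equiv.apply_symm_apply]

lemma bequiv_inn (α : R.Inn) (x y : Q) :
    R.BEquiv ((α : Equiv.Perm Q) x) ((α : Equiv.Perm Q) y) ↔ R.BEquiv x y := by
  simp [BEquiv, rho_inn]

open scoped Classical in
/-- The coboundary of a matrix on `Q`: the first-order change of an operator on `AQ ⊗ AQ`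
under conjugation by `(1 + a) ⊗ (1 + a)`. -/
def coboundary : (Q → Q → A) →ₗ[A] (Q → Q → Q → Q → A) where
  toFun a x y p q := (if y = q then a x p - a (R.act x y) (R.act p y) else 0) +
    a y q * ((if x = p then 1 else 0) - (if R.act x y = R.act p q then 1 else 0))
  map_add' a b := by
    ext x y p q
    simp only [Pi.add_apply]
    split_ifs <;> ring
  map_smul' c a := by
    ext x y p q
    simp only [Pi.smul_apply, smul_eq_mul, RingHom.id_apply]
    split_ifs <;> ring

open scoped Classical in
/-- The linearised Yang–Baxter equation at `c_Q`. -/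
def linYB : (Q → Q → Q → Q → A) →ₗ[A] (Q → Q → Q → Q → Q → Q → A) where
  toFun g x y z p q r :=
    (if z = r then g x y p q - g (R.act x z) (R.act y z) (R.act p z) (R.act q z) else 0) +
    (if y = q then g (R.act x y) z (R.act p y) r else 0) -
    (if R.act y z = R.act q r then g x z p r else 0) +
    ((if R.act (R.act x y) z = R.act (R.act p q) r then 1 else 0) -
      (if x = p then 1 else 0)) * g y z q r
  map_add' a b := by
    ext x y z p q r
    simp only [Pi.add_apply]
    split_ifs <;> ring
  map_smul' c a := by
    ext x y z p q r
    simp only [Pi.smul_apply, smul_eq_mul, RingHom.id_apply]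
    split_ifs <;> ring

open scoped Classical in
lemma coboundary_apply (a : Q → Q → A) (x y p q : Q) : R.coboundary a x y p q =
    (if y = q then a x p - a (R.act x y) (R.act p y) else 0) +
    a y q * ((if x = p then 1 else 0) - (if R.act x y = R.act p q then 1 else 0)) := rfl

open scoped Classical in
lemma linYB_apply (g : Q → Q → Q → Q → A) (x y z p q r : Q) : R.linYB g x y z p q r =
    (if z = r then g x y p q - g (R.act x z) (R.act y z) (R.act p z) (R.act q z) else 0) +
    (if y = q then g (R.act x y) z (R.act p y) r else 0) -
    (if R.act y z = R.act q r then g x z p r else 0) +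
    ((if R.act (R.act x y) z = R.act (R.act p q) r then 1 else 0) -
      (if x = p then 1 else 0)) * g y z q r := rfl

/-- Simultaneous translation of the two rows and two columns of a matrix on `Q × Q`. -/
def shift (w : R.Inn) (g : Q → Q → Q → Q → A) : Q → Q → Q → Q → A :=
  fun x y p q => g ((w : Equiv.Perm Q) x) ((w : Equiv.Perm Q) y) ((w : Equiv.Perm Q) p)
    ((w : Equiv.Perm Q) q)

open scoped Classical in
lemma coboundary_shift (w : R.Inn) (a : Q → Q → A) :
    R.shift w (R.coboundary a) =
      R.coboundary (fun x p => a ((w : Equiv.Perm Q) x) ((w : Equiv.Perm Q) p)) := by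
  ext x y p q
  simp only [shift, coboundary_apply, ← R.inn_act w, Equiv.apply_eq_iff_eq]

open scoped Classical in
lemma linYB_shift (w : R.Inn) (g : Q → Q → Q → Q → A) (x y z p q r : Q) :
    R.linYB (R.shift w g) x y z p q r =
      R.linYB g ((w : Equiv.Perm Q) x) ((w : Equiv.Perm Q) y) ((w : Equiv.Perm Q) z)
        ((w : Equiv.Perm Q) p) ((w : Equiv.Perm Q) q) ((w : Equiv.Perm Q) r) := by
  simp only [shift, linYB_apply, ← R.inn_act w, Equiv.apply_eq_iff_eq]

/-- A matrix on `Q` with entries in `I` and finitely supported rows. -/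
def IsMat (I : Ideal A) (a : Q → Q → A) : Prop :=
  (∀ x p, a x p ∈ I) ∧ ∀ x, (Function.support (a x)).Finite

lemma IsMat.add {I : Ideal A} {a b : Q → Q → A} (ha : IsMat I a) (hb : IsMat I b) :
    IsMat I (a + b) :=
  ⟨fun x p => I.add_mem (ha.1 x p) (hb.1 x p),
    fun x => ((ha.2 x).union (hb.2 x)).subset (Function.support_add _ _)⟩

lemma IsMat.smul {I : Ideal A} {a : Q → Q → A} (ha : IsMat I a) (c : A) : IsMat I (c • a) :=
  ⟨fun x p => I.mul_mem_left c (ha.1 x p),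
    fun x => (ha.2 x).subset (Function.support_const_smul_subset c (a x))⟩

lemma IsMat.zero {I : Ideal A} : IsMat I (0 : Q → Q → A) :=
  ⟨fun _ _ => I.zero_mem, fun x => by simp⟩

lemma IsMat.neg {I : Ideal A} {a : Q → Q → A} (ha : IsMat I a) : IsMat I (-a) := by
  simpa using ha.smul (-1)

lemma IsMat.sum {I : Ideal A} {ι : Type*} (s : Finset ι) {a : ι → Q → Q → A}
    (ha : ∀ i, IsMat I (a i)) : IsMat I (∑ i ∈ s, a i) := by
  classical
  induction s using Finset.induction_on with
  | empty => simpa using IsMat.zero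
  | insert i s hi ih => rw [Finset.sum_insert hi]; exact (ha i).add ih

lemma IsMat.comp {I : Ideal A} {a : Q → Q → A} (ha : IsMat I a) (w : Equiv.Perm Q) :
    IsMat I (fun x p => a (w x) (w p)) :=
  ⟨fun _ _ => ha.1 _ _, fun x => (ha.2 (w x)).preimage w.injective.injOn⟩

open scoped Classical in
lemma exists_sub_shift_eq_coboundary {I : Ideal A} {g : Q → Q → Q → Q → A}
    (hI : ∀ x y p q, g x y p q ∈ I)
    (hfin : ∀ x y, {t : Q × Q | g x y t.1 t.2 ≠ 0}.Finite)
    (hg : R.linYB g = 0) (w : R.Inn) :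
    ∃ h : Q → Q → A, IsMat I h ∧ g - R.shift w g = R.coboundary h := by
  obtain ⟨w, hw⟩ := w
  induction hw using Subgroup.closure_induction with
  | mem a ha =>
    obtain ⟨z, rfl⟩ := ha
    refine ⟨fun x p => g x z p z, ⟨fun _ _ => hI _ _ _ _, fun x => ?_⟩, ?_⟩
    · exact ((hfin x z).preimage (f := fun p => (p, z))
        (fun a _ b _ h => (Prod.ext_iff.1 h).1))
    · ext x y p q
      have h := congrFun (congrFun (congrFun (congrFun (congrFun (congrFun hg x) y) z) p) q) z
      rw [linYB_apply] at h
      simp only [if_true, act_left_inj, Pi.zero_apply] at h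
      simp only [coboundary_apply, Pi.sub_apply, shift, rho_apply]
      split_ifs at h ⊢ <;> linear_combination h
  | one => exact ⟨0, IsMat.zero, by ext; simp [shift]⟩
  | mul a b ha hb iha ihb =>
    obtain ⟨h₁, i₁, e₁⟩ := iha
    obtain ⟨h₂, i₂, e₂⟩ := ihb
    refine ⟨h₂ + fun x p => h₁ (b x) (b p), i₂.add (i₁.comp b), ?_⟩
    rw [map_add, ← R.coboundary_shift ⟨b, hb⟩, ← e₁, ← e₂]
    ext
    simp [shift]
  | inv a ha ih =>
    obtain ⟨h, i, e⟩ := ih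
    refine ⟨-fun x p => h (a⁻¹ x) (a⁻¹ p), (i.comp a⁻¹).neg, ?_⟩
    rw [map_neg, ← R.coboundary_shift ⟨a⁻¹, inv_mem ha⟩, ← e]
    ext
    simp [shift]

/-- Matrix form of entropicity. -/
def EntropicMat (g : Q → Q → Q → Q → A) : Prop :=
  (∀ x y u v : Q, (¬ R.BEquiv x u ∨ ¬ R.BEquiv y v) → g x y u v = 0) ∧
  ∀ (x y u v : Q) (α β : R.Inn),
    g ((α : Equiv.Perm Q) x) ((β : Equiv.Perm Q) y)
      ((α : Equiv.Perm Q) u) ((β : Equiv.Perm Q) v) = g x y u v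

variable {R} in
lemma EntropicMat.add {g h : Q → Q → Q → Q → A} (hg : R.EntropicMat g) (hh : R.EntropicMat h) :
    R.EntropicMat (g + h) :=
  ⟨fun x y u v H => by simp [hg.1 x y u v H, hh.1 x y u v H],
    fun x y u v α β => by simp [hg.2 x y u v α β, hh.2 x y u v α β]⟩

open scoped Classical in
lemma exists_entropicMat_of_shift_eq [Finite R.Inn] {I : Ideal A} {g : Q → Q → Q → Q → A}
    (hI : ∀ x y p q, g x y p q ∈ I)
    (hfin : ∀ x y, {t : Q × Q | g x y t.1 t.2 ≠ 0}.Finite)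
    (hg : R.linYB g = 0) (hs : ∀ w, R.shift w g = g) :
    ∃ a : Q → Q → A, IsMat I a ∧ R.EntropicMat (g + R.coboundary a) := by
  classical
  have hs' : ∀ (w : R.Inn) (x y p q : Q), g ((w : Equiv.Perm Q) x) ((w : Equiv.Perm Q) y)
      ((w : Equiv.Perm Q) p) ((w : Equiv.Perm Q) q) = g x y p q := fun w x y p q =>
    congrFun (congrFun (congrFun (congrFun (hs w) x) y) p) q
  have hD : ∀ x y z p q r, (if y = q then g (R.act x y) z (R.act p y) r else 0) -
      (if R.act y z = R.act q r then g x z p r else 0) +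
      ((if R.act (R.act x y) z = R.act (R.act p q) r then 1 else 0) -
      (if x = p then 1 else 0)) * g y z q r = 0 := by
    intro x y z p q r
    have h := congrFun (congrFun (congrFun (congrFun (congrFun (congrFun hg x) y) z) p) q) r
    have h' := hs' (R.inn z) x y p q
    simp only [coe_inn_apply] at h'
    rw [linYB_apply] at h
    simpa [h'] using h
  have left : ∀ x y z p r, R.BEquiv z r → g (R.act x y) z (R.act p y) r = g x z p r := by
    intro x y z p r h
    have h1 := hD x y z p y r
    simp only [if_true, h.act_eq, act_left_inj] at h1
    linear_combination h1
  have quasi : ∀ x z p r, R.BEquiv z r → ¬ R.BEquiv x p → g x z p r = 0 := by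
    intro y z q r h hn
    obtain ⟨x, hx⟩ := R.exists_act_ne hn
    have h1 := hD x y z x q r
    have hyq : y ≠ q := fun e => hn (by rw [e]; rfl)
    simp only [h.act_eq, act_left_inj, if_neg hyq, if_neg hx, if_true] at h1
    linear_combination -h1
  have leftInn : ∀ (α : R.Inn) (x z p r : Q), R.BEquiv z r →
      g ((α : Equiv.Perm Q) x) z ((α : Equiv.Perm Q) p) r = g x z p r := by
    rintro ⟨α, hα⟩
    induction hα using Subgroup.closure_induction with
    | mem a ha =>
      obtain ⟨y, rfl⟩ := ha
      intro x z p r h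
      exact left x y z p r h
    | one => intros; rfl
    | mul a b _ _ iha ihb =>
      intro x z p r h
      have h1 := iha (b x) z (b p) r h
      have h2 := ihb x z p r h
      simp only [Equiv.Perm.mul_apply] at *
      rw [h1, h2]
    | inv a _ ih =>
      intro x z p r h
      have h1 := ih (a⁻¹ x) z (a⁻¹ p) r h
      simpa using h1.symm
  rcases isEmpty_or_nonempty Q with hQ | hQ
  · exact ⟨0, IsMat.zero, fun x => isEmptyElim x, fun x => isEmptyElim x⟩
  have hex : ∀ s t : Equiv.Perm Q, s ≠ t → ∃ y : Q, s y ≠ t y := fun s t h => by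
    by_contra! H
    exact h (Equiv.ext H)
  choose! Y hY using hex
  let k : Q → Q → A := fun z r =>
    if R.rho z = R.rho r then 0 else g (Y (R.rho z) (R.rho r)) z (Y (R.rho z) (R.rho r)) r
  have k_on : ∀ z r, R.BEquiv z r → k z r = 0 := fun z r h => if_pos h
  have off : ∀ x z p r, ¬ R.BEquiv z r → g x z p r =
      ((if x = p then 1 else 0) - (if R.act x z = R.act p r then 1 else 0)) * k z r := by
    intro x z p r h
    obtain ⟨x, rfl⟩ := (R.act_bijective (Y (R.rho z) (R.rho r))).2 x
    obtain ⟨p, rfl⟩ := (R.act_bijective (Y (R.rho z) (R.rho r))).2 p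
    have h1 := hD x (Y (R.rho z) (R.rho r)) z p (Y (R.rho z) (R.rho r)) r
    have h2 : R.act (Y (R.rho z) (R.rho r)) z ≠ R.act (Y (R.rho z) (R.rho r)) r := hY _ _ h
    have h3 : g (Y (R.rho z) (R.rho r)) z (Y (R.rho z) (R.rho r)) r = k z r :=
      (if_neg h).symm
    rw [if_pos rfl, if_neg h2, h3] at h1
    simp only [act_left_inj]
    linear_combination h1
  have k_eq : ∀ y z r, R.act y z ≠ R.act y r → k z r = g y z y r := by
    intro y z r h
    rw [off y z y r fun e => h (e.act_eq y), if_pos rfl, if_neg h]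
    ring
  have k_inn : ∀ (α : R.Inn) z r, k ((α : Equiv.Perm Q) z) ((α : Equiv.Perm Q) r) = k z r := by
    intro α z r
    by_cases h : R.BEquiv z r
    · rw [k_on _ _ h, k_on _ _ ((R.bequiv_inn α z r).2 h)]
    · obtain ⟨y, hy⟩ := R.exists_act_ne h
      rw [k_eq y z r hy, k_eq ((α : Equiv.Perm Q) y), hs']
      rwa [← inn_act, ← inn_act, Ne, Equiv.apply_eq_iff_eq]
  have key : g + R.coboundary (-k) = fun x y p q => if R.BEquiv y q then g x y p q else 0 := by
    ext x y p q
    rw [map_neg]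
    simp only [Pi.add_apply, Pi.neg_apply, coboundary_apply]
    have h1 : k (R.act x y) (R.act p y) = k x p := k_inn (R.inn y) x p
    rw [h1]
    by_cases h : R.BEquiv y q
    · rw [if_pos h, k_on _ _ h]
      simp
    · have hne : y ≠ q := fun e => h (by rw [e]; rfl)
      rw [if_neg h, if_neg hne, off x y p q h]
      ring
  refine ⟨-k, IsMat.neg ⟨fun z r => ?_, fun z => ?_⟩, ?_⟩
  · change (if _ then _ else _) ∈ I
    split_ifs
    · exact I.zero_mem
    · exact hI _ _ _ _
  · have hU : (⋃ s : R.Inn, {r | g (Y (R.rho z) s) z (Y (R.rho z) s) r ≠ 0}).Finite :=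
      Set.finite_iUnion fun s => (hfin (Y (R.rho z) s) z).preimage (f := fun r => (_, r))
        (fun a _ b _ h => (Prod.ext_iff.1 h).2)
    refine hU.subset fun r hr => Set.mem_iUnion.2 ⟨R.inn r, fun h0 => hr ?_⟩
    change (if _ then _ else _) = _
    split_ifs
    · rfl
    · exact h0
  · rw [key]
    refine ⟨fun x y u v H => ?_, fun x y u v α β => ?_⟩
    · dsimp only
      by_cases h : R.BEquiv y v
      · rw [if_pos h]
        exact quasi x y u v h (H.resolve_right (not_not_intro h))
      · rw [if_neg h]
    · simp only [bequiv_inn]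
      by_cases h : R.BEquiv y v
      · rw [if_pos h, if_pos h, ← leftInn (β * α⁻¹) _ _ _ _ ((R.bequiv_inn β y v).2 h)]
        simpa using hs' β x y u v
      · rw [if_neg h, if_neg h]

lemma sum_inn_act {B : Type*} [AddCommGroup B] [Fintype R.Inn] (z : Q) (F : R.Inn → B) :
    ∑ α : R.Inn, F (R.inn z * α) = ∑ α : R.Inn, F α :=
  Fintype.sum_equiv (Equiv.mulLeft (R.inn z)) _ _ fun _ => rfl

open scoped Classical in
lemma linYB_eq_zero [Fintype R.Inn] (hunit : IsUnit ((Fintype.card R.Inn : A)))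
    {g : Q → Q → Q → Q → A}
    (hqd : ∀ x y z p q r, (¬ R.BEquiv x p ∨ ¬ R.BEquiv y q ∨ ¬ R.BEquiv z r) →
      R.linYB g x y z p q r = 0)
    (heq : ∀ x y z p q r (α β γ : R.Inn),
      R.linYB g ((α : Equiv.Perm Q) x) ((β : Equiv.Perm Q) y) ((γ : Equiv.Perm Q) z)
        ((α : Equiv.Perm Q) p) ((β : Equiv.Perm Q) q) ((γ : Equiv.Perm Q) r) =
      R.linYB g x y z p q r) : R.linYB g = 0 := by
  ext x y z p q r
  by_cases H : ¬ R.BEquiv x p ∨ ¬ R.BEquiv y q ∨ ¬ R.BEquiv z r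
  · exact hqd x y z p q r H
  push Not at H
  obtain ⟨hx, hy, hz⟩ := H
  have key : ∀ γ : R.Inn, ∑ β : R.Inn, ∑ α : R.Inn,
      R.linYB g ((α : Equiv.Perm Q) x) ((β : Equiv.Perm Q) y) ((γ : Equiv.Perm Q) z)
        ((α : Equiv.Perm Q) p) ((β : Equiv.Perm Q) q) ((γ : Equiv.Perm Q) r) = 0 := by
    intro γ
    have hz' := (R.bequiv_inn γ z r).2 hz
    generalize (γ : Equiv.Perm Q) z = z at hz'
    generalize (γ : Equiv.Perm Q) r = r at hz'
    have e1 : ∀ α β : R.Inn, R.linYB g ((α : Equiv.Perm Q) x) ((β : Equiv.Perm Q) y) z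
        ((α : Equiv.Perm Q) p) ((β : Equiv.Perm Q) q) r =
        (if z = r then g ((α : Equiv.Perm Q) x) ((β : Equiv.Perm Q) y)
          ((α : Equiv.Perm Q) p) ((β : Equiv.Perm Q) q) -
          g (((R.inn z * α : R.Inn) : Equiv.Perm Q) x) (((R.inn z * β : R.Inn) : Equiv.Perm Q) y)
          (((R.inn z * α : R.Inn) : Equiv.Perm Q) p) (((R.inn z * β : R.Inn) : Equiv.Perm Q) q)
          else 0) +
        (if y = q then g (((R.inn ((β : Equiv.Perm Q) y) * α : R.Inn) : Equiv.Perm Q) x) z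
            (((R.inn ((β : Equiv.Perm Q) y) * α : R.Inn) : Equiv.Perm Q) p) r -
          g ((α : Equiv.Perm Q) x) z ((α : Equiv.Perm Q) p) r else 0) := by
      intro α β
      have hy' := (R.bequiv_inn β y q).2 hy
      rw [linYB_apply]
      simp only [← hz'.act_eq, ← hy'.act_eq, act_left_inj, Equiv.apply_eq_iff_eq,
        Subgroup.coe_mul, Equiv.Perm.mul_apply, coe_inn_apply]
      split_ifs <;> ring
    simp only [e1, Finset.sum_add_distrib]
    have t1 : z = r → ∑ β : R.Inn, ∑ α : R.Inn, (g ((α : Equiv.Perm Q) x) ((β : Equiv.Perm Q) y)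
          ((α : Equiv.Perm Q) p) ((β : Equiv.Perm Q) q) -
          g (((R.inn z * α : R.Inn) : Equiv.Perm Q) x) (((R.inn z * β : R.Inn) : Equiv.Perm Q) y)
          (((R.inn z * α : R.Inn) : Equiv.Perm Q) p)
          (((R.inn z * β : R.Inn) : Equiv.Perm Q) q)) = 0 := by
      intro _
      simp only [Finset.sum_sub_distrib]
      rw [R.sum_inn_act z fun β => ∑ α : R.Inn, g (((R.inn z * α : R.Inn) : Equiv.Perm Q) x)
        ((β : Equiv.Perm Q) y) (((R.inn z * α : R.Inn) : Equiv.Perm Q) p) ((β : Equiv.Perm Q) q),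
        sub_eq_zero]
      exact Finset.sum_congr rfl fun β _ => (R.sum_inn_act z fun α : R.Inn =>
        g ((α : Equiv.Perm Q) x) ((β : Equiv.Perm Q) y) ((α : Equiv.Perm Q) p)
          ((β : Equiv.Perm Q) q)).symm
    have t2 : ∀ β : R.Inn, ∑ α : R.Inn, (g
            (((R.inn ((β : Equiv.Perm Q) y) * α : R.Inn) : Equiv.Perm Q) x) z
            (((R.inn ((β : Equiv.Perm Q) y) * α : R.Inn) : Equiv.Perm Q) p) r -
          g ((α : Equiv.Perm Q) x) z ((α : Equiv.Perm Q) p) r) = 0 := by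
      intro β
      rw [Finset.sum_sub_distrib, sub_eq_zero]
      exact R.sum_inn_act ((β : Equiv.Perm Q) y) fun α : R.Inn =>
        g ((α : Equiv.Perm Q) x) z ((α : Equiv.Perm Q) p) r
    by_cases h1 : z = r <;> by_cases h2 : y = q
    · simp only [if_pos h1, if_pos h2, t1 h1, t2, Finset.sum_const_zero, add_zero]
    · simp only [if_pos h1, if_neg h2, t1 h1, Finset.sum_const_zero, add_zero]
    · simp only [if_neg h1, if_pos h2, t2, Finset.sum_const_zero, add_zero]
    · simp only [if_neg h1, if_neg h2, Finset.sum_const_zero, add_zero]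
  simp only [heq, Finset.sum_const, Finset.card_univ, nsmul_eq_mul] at key
  have h1 := key 1
  rwa [hunit.mul_right_eq_zero, hunit.mul_right_eq_zero] at h1

lemma exists_entropicMat [Fintype R.Inn] (hunit : IsUnit ((Fintype.card R.Inn : A)))
    {I : Ideal A} {g : Q → Q → Q → Q → A}
    (hI : ∀ x y p q, g x y p q ∈ I)
    (hfin : ∀ x y, {t : Q × Q | g x y t.1 t.2 ≠ 0}.Finite)
    (hg : R.linYB g = 0) :
    ∃ a : Q → Q → A, IsMat I a ∧ R.EntropicMat (g + R.coboundary a) := by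
  obtain ⟨c, hc⟩ := hunit.exists_left_inv
  choose h hm hh using R.exists_sub_shift_eq_coboundary hI hfin hg
  let G : Q → Q → Q → Q → A := c • ∑ w : R.Inn, R.shift w g
  have hG : ∀ x y p q, G x y p q = c * ∑ w : R.Inn, R.shift w g x y p q := by
    intro x y p q
    simp [G, Finset.sum_apply]
  have hG1 : g + R.coboundary (-(c • ∑ w : R.Inn, h w)) = G := by
    rw [map_neg, map_smul, map_sum]
    simp only [← hh, Finset.sum_sub_distrib, Finset.sum_const, Finset.card_univ, smul_sub]
    rw [← Nat.cast_smul_eq_nsmul A, smul_smul, hc, one_smul]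
    abel
  obtain ⟨k, hk, hk'⟩ := R.exists_entropicMat_of_shift_eq (I := I) (g := G)
    (fun x y p q => by
      rw [hG]
      exact I.mul_mem_left _ (I.sum_mem fun w _ => hI _ _ _ _))
    (fun x y => by
      have hU : (⋃ w : R.Inn, {t : Q × Q | R.shift w g x y t.1 t.2 ≠ 0}).Finite :=
        Set.finite_iUnion fun w => (hfin _ _).preimage
          (f := fun t : Q × Q => ((w : Equiv.Perm Q) t.1, (w : Equiv.Perm Q) t.2))
          (fun a _ b _ e => by simpa [Prod.ext_iff] using e)
      refine hU.subset fun t ht => ?_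
      by_contra H
      simp only [Set.mem_iUnion, Set.mem_ofPred_eq, not_exists, not_not] at H
      exact ht (by simp [hG, H]))
    (by
      refine LinearMap.mem_ker.1 (Submodule.smul_mem _ _ (Submodule.sum_mem _ fun w _ => ?_))
      rw [LinearMap.mem_ker]
      ext x y z p q r
      rw [linYB_shift, hg]
      rfl)
    (fun w => by
      ext x y p q
      simp only [shift, hG]
      congr 1
      exact Fintype.sum_equiv (Equiv.mulRight w) _ _ fun v => rfl)
  refine ⟨-(c • ∑ w : R.Inn, h w) + k, (IsMat.neg ((IsMat.sum _ hm).smul c)).add hk, ?_⟩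
  rwa [map_add, ← add_assoc, hG1]

end YBRack

section Braids

variable {A M : Type*} [CommRing A] [AddCommGroup M] [Module A M]

/-- The action of an endomorphism of `M ⊗ M` on the first two factors of `M ⊗ M ⊗ M`. -/
def onLeft (f : Module.End A (M ⊗[A] M)) : Module.End A ((M ⊗[A] M) ⊗[A] M) :=
  LinearMap.rTensor M f

/-- The action of an endomorphism of `M ⊗ M` on the last two factors of `M ⊗ M ⊗ M`. -/
def onRight (f : Module.End A (M ⊗[A] M)) : Module.End A ((M ⊗[A] M) ⊗[A] M) :=
  (TensorProduct.assoc A M M M).symm.toLinearMap ∘ₗ (LinearMap.lTensor M f) ∘ₗ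
    (TensorProduct.assoc A M M M).toLinearMap

/-- The transposition of the two factors of `M ⊗ M`. -/
def flip2 (A M : Type*) [CommRing A] [AddCommGroup M] [Module A M] :
    Module.End A (M ⊗[A] M) := (TensorProduct.comm A M M).toLinearMap

/-- The action of an endomorphism of `M ⊗ M` on the outer two factors of `M ⊗ M ⊗ M`. -/
def onOuter (f : Module.End A (M ⊗[A] M)) : Module.End A ((M ⊗[A] M) ⊗[A] M) :=
  onLeft (flip2 A M) * onRight f * onLeft (flip2 A M)

lemma yBE_iff (c : Module.End A (M ⊗[A] M)) :
    YBE c ↔ onLeft c * (onRight c * onLeft c) = onRight c * (onLeft c * onRight c) := Iff.rfl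

lemma onLeft_tmul (f : Module.End A (M ⊗[A] M)) (t : M ⊗[A] M) (z : M) :
    onLeft f (t ⊗ₜ z) = f t ⊗ₜ z := rfl

lemma onRight_tmul (f : Module.End A (M ⊗[A] M)) (x y z : M) :
    onRight f ((x ⊗ₜ y) ⊗ₜ z) = (TensorProduct.assoc A M M M).symm (x ⊗ₜ f (y ⊗ₜ z)) := rfl

lemma onLeft_mul (f g : Module.End A (M ⊗[A] M)) : onLeft (f * g) = onLeft f * onLeft g :=
  LinearMap.rTensor_comp M f g

lemma onRight_mul (f g : Module.End A (M ⊗[A] M)) : onRight (f * g) = onRight f * onRight g := by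
  ext x y z
  simp [onRight]

lemma onLeft_add (f g : Module.End A (M ⊗[A] M)) : onLeft (f + g) = onLeft f + onLeft g :=
  LinearMap.rTensor_add M f g

lemma onRight_add (f g : Module.End A (M ⊗[A] M)) : onRight (f + g) = onRight f + onRight g := by
  simp [onRight, LinearMap.lTensor_add, LinearMap.comp_add, LinearMap.add_comp]

lemma onLeft_one : onLeft (1 : Module.End A (M ⊗[A] M)) = 1 := LinearMap.rTensor_id _ _

lemma onRight_one : onRight (1 : Module.End A (M ⊗[A] M)) = 1 := by
  ext x y z
  simp [onRight]

lemma onLeft_sum {ι : Type*} (s : Finset ι) (f : ι → Module.End A (M ⊗[A] M)) :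
    onLeft (∑ i ∈ s, f i) = ∑ i ∈ s, onLeft (f i) :=
  map_sum (AddMonoidHom.mk' onLeft onLeft_add) f s

lemma onRight_sum {ι : Type*} (s : Finset ι) (f : ι → Module.End A (M ⊗[A] M)) :
    onRight (∑ i ∈ s, f i) = ∑ i ∈ s, onRight (f i) :=
  map_sum (AddMonoidHom.mk' onRight onRight_add) f s

lemma onLeft_map (X Y : Module.End A M) :
    onLeft (TensorProduct.map X Y) = TensorProduct.map (TensorProduct.map X Y) 1 := rfl

lemma onRight_map (X Y : Module.End A M) :
    onRight (TensorProduct.map X Y) = TensorProduct.map (TensorProduct.map 1 X) Y := by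
  ext x y z
  simp [onRight]

lemma flip2_mul_flip2 : flip2 A M * flip2 A M = 1 := by
  ext x y
  simp [flip2]

lemma onLeft_flip2_mul_self : onLeft (flip2 A M) * onLeft (flip2 A M) = 1 := by
  rw [← onLeft_mul, flip2_mul_flip2, onLeft_one]

lemma onRight_flip2_mul_self : onRight (flip2 A M) * onRight (flip2 A M) = 1 := by
  rw [← onRight_mul, flip2_mul_flip2, onRight_one]

lemma onRight_mul_onLeft_flip2 (f : Module.End A (M ⊗[A] M)) :
    onRight f * onLeft (flip2 A M) = onLeft (flip2 A M) * onOuter f := by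
  rw [onOuter, mul_assoc, ← mul_assoc, onLeft_flip2_mul_self, one_mul]

lemma onOuter_mul_onLeft_flip2 (f : Module.End A (M ⊗[A] M)) :
    onOuter f * onLeft (flip2 A M) = onLeft (flip2 A M) * onRight f := by
  rw [onOuter, mul_assoc, onLeft_flip2_mul_self, mul_one]

lemma rotate_assoc_symm (x : M) (t : M ⊗[A] M) :
    onRight (flip2 A M) (onLeft (flip2 A M) ((TensorProduct.assoc A M M M).symm (x ⊗ₜ t))) =
      t ⊗ₜ x := by
  induction t using TensorProduct.induction_on with
  | zero => simp
  | tmul y z => simp [onLeft_tmul, onRight_tmul, flip2]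
  | add a b ha hb => simp only [TensorProduct.tmul_add, map_add, ha, hb, TensorProduct.add_tmul]

lemma onLeft_mul_rotate (f : Module.End A (M ⊗[A] M)) :
    onLeft f * (onRight (flip2 A M) * onLeft (flip2 A M)) =
      (onRight (flip2 A M) * onLeft (flip2 A M)) * onRight f := by
  apply TensorProduct.ext_threefold
  intro x y z
  simp only [Module.End.mul_apply, onRight_tmul f, rotate_assoc_symm]
  simp [onLeft_tmul, onRight_tmul, flip2]

lemma onLeft_mul_onRight_flip2 (f : Module.End A (M ⊗[A] M)) :
    onLeft f * onRight (flip2 A M) = onRight (flip2 A M) * onOuter f := by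
  have h := congrArg (· * onLeft (flip2 A M)) (onLeft_mul_rotate f)
  simp only [mul_assoc, onLeft_flip2_mul_self, mul_one] at h
  rw [h, onOuter, mul_assoc]

lemma onOuter_mul_onRight_flip2 (f : Module.End A (M ⊗[A] M)) :
    onOuter f * onRight (flip2 A M) = onRight (flip2 A M) * onLeft f := by
  have h : onOuter f = onRight (flip2 A M) * (onLeft f * onRight (flip2 A M)) := by
    rw [onLeft_mul_onRight_flip2, ← mul_assoc, onRight_flip2_mul_self, one_mul]
  rw [h, mul_assoc, mul_assoc, onRight_flip2_mul_self, mul_one]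

variable {S : Set (Module.End A M)} {e : Module.End A (M ⊗[A] M)}

lemma commute_onLeft (he : ∀ X ∈ S, ∀ Y ∈ S, Commute e (TensorProduct.map X Y))
    {X Y Z : Module.End A M} (hX : X ∈ S) (hY : Y ∈ S) :
    Commute (onLeft e) (TensorProduct.map (TensorProduct.map X Y) Z) := by
  have h := he X hX Y hY
  have h1 : TensorProduct.map (TensorProduct.map X Y) Z =
      onLeft (TensorProduct.map X Y) * TensorProduct.map 1 Z := by
    rw [onLeft_map, ← TensorProduct.map_mul, mul_one, one_mul]
  have h2 : Commute (onLeft e) (TensorProduct.map 1 Z) := by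
    change onLeft e * _ = _ * onLeft e
    change TensorProduct.map e 1 * _ = _ * TensorProduct.map e 1
    rw [← TensorProduct.map_mul, ← TensorProduct.map_mul, mul_one, mul_one, one_mul, one_mul]
  rw [h1]
  refine Commute.mul_right ?_ h2
  change _ * _ = _ * _
  rw [← onLeft_mul, ← onLeft_mul, h.eq]

lemma commute_onRight (he : ∀ X ∈ S, ∀ Y ∈ S, Commute e (TensorProduct.map X Y))
    {X Y Z : Module.End A M} (hY : Y ∈ S) (hZ : Z ∈ S) :
    Commute (onRight e) (TensorProduct.map (TensorProduct.map X Y) Z) := by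
  have h := he Y hY Z hZ
  have h1 : TensorProduct.map (TensorProduct.map X Y) Z =
      TensorProduct.map (TensorProduct.map X 1) 1 * onRight (TensorProduct.map Y Z) := by
    rw [onRight_map, ← TensorProduct.map_mul, ← TensorProduct.map_mul, mul_one, one_mul, one_mul]
  have h2 : Commute (onRight e) (TensorProduct.map (TensorProduct.map X 1) 1) := by
    have h3 : ∀ (x : M) (t : M ⊗[A] M), (TensorProduct.map (TensorProduct.map X 1) 1)
        ((TensorProduct.assoc A M M M).symm (x ⊗ₜ t)) =
        (TensorProduct.assoc A M M M).symm (X x ⊗ₜ t) := by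
      intro x t
      induction t using TensorProduct.induction_on with
      | zero => simp
      | tmul y z => simp
      | add a b ha hb => simp only [TensorProduct.tmul_add, map_add, ha, hb]
    apply TensorProduct.ext_threefold
    intro x y z
    simp only [Module.End.mul_apply, onRight_tmul, h3]
    simp [onRight_tmul]
  rw [h1]
  refine Commute.mul_right h2 ?_
  change _ * _ = _ * _
  rw [← onRight_mul, ← onRight_mul, h.eq]

lemma onLeft_flip2_mul_map (X Y Z : Module.End A M) :
    onLeft (flip2 A M) * TensorProduct.map (TensorProduct.map X Y) Z =
      TensorProduct.map (TensorProduct.map Y X) Z * onLeft (flip2 A M) := by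
  apply TensorProduct.ext_threefold
  intro x y z
  simp [onLeft_tmul, flip2]

lemma commute_onOuter (he : ∀ X ∈ S, ∀ Y ∈ S, Commute e (TensorProduct.map X Y))
    {X Y Z : Module.End A M} (hX : X ∈ S) (hZ : Z ∈ S) :
    Commute (onOuter e) (TensorProduct.map (TensorProduct.map X Y) Z) := by
  change _ * _ = _ * _
  rw [onOuter, mul_assoc, onLeft_flip2_mul_map, mul_assoc (onLeft _),
    ← mul_assoc (onRight e), (commute_onRight he hX hZ).eq, mul_assoc, ← mul_assoc (onLeft _),
    onLeft_flip2_mul_map]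
  simp only [mul_assoc]

section Passing

variable {ι : Type*} [Fintype ι] {X Y : ι → Module.End A M} {b : Module.End A (M ⊗[A] M)}

lemma commute_onLeft_sum {F : Module.End A ((M ⊗[A] M) ⊗[A] M)}
    (hF : ∀ i, Commute F (TensorProduct.map (TensorProduct.map (X i) (Y i)) 1)) :
    Commute F (onLeft (∑ i, TensorProduct.map (X i) (Y i))) := by
  rw [onLeft_sum]
  exact Commute.sum_right _ _ _ fun i _ => hF i

lemma commute_onRight_sum {F : Module.End A ((M ⊗[A] M) ⊗[A] M)}
    (hF : ∀ i, Commute F (TensorProduct.map (TensorProduct.map 1 (X i)) (Y i))) :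
    Commute F (onRight (∑ i, TensorProduct.map (X i) (Y i))) := by
  rw [onRight_sum]
  exact Commute.sum_right _ _ _ fun i _ => onRight_map (X i) (Y i) ▸ hF i

/-- Entropic operators can be moved to the right of the braids built from
`b = flip ∘ ∑ X i ⊗ Y i`. -/
lemma braid_mul (he : ∀ X ∈ S, ∀ Y ∈ S, Commute e (TensorProduct.map X Y))
    (h1 : 1 ∈ S) (hX : ∀ i, X i ∈ S) (hY : ∀ i, Y i ∈ S)
    (hb : b = flip2 A M * ∑ i, TensorProduct.map (X i) (Y i)) :
    (onLeft b * onLeft e) * ((onRight b * onRight e) * (onLeft b * onLeft e)) =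
        onLeft b * (onRight b * (onLeft b * (onRight e * (onOuter e * onLeft e)))) ∧
    (onRight b * onRight e) * ((onLeft b * onLeft e) * (onRight b * onRight e)) =
        onRight b * (onLeft b * (onRight b * (onLeft e * (onOuter e * onRight e)))) := by
  have p1 : onLeft e * onRight b = onRight b * onOuter e := by
    rw [hb, onRight_mul, ← mul_assoc, onLeft_mul_onRight_flip2, mul_assoc, mul_assoc,
      (commute_onRight_sum fun i => commute_onOuter he h1 (hY i)).eq]
  have p2 : onRight e * onLeft b = onLeft b * onOuter e := by
    rw [hb, onLeft_mul, ← mul_assoc, onRight_mul_onLeft_flip2, mul_assoc, mul_assoc,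
      (commute_onLeft_sum fun i => commute_onOuter he (hX i) h1).eq]
  have p3 : onOuter e * onLeft b = onLeft b * onRight e := by
    rw [hb, onLeft_mul, ← mul_assoc, onOuter_mul_onLeft_flip2, mul_assoc, mul_assoc,
      (commute_onLeft_sum fun i => commute_onRight he (hY i) h1).eq]
  have p4 : onOuter e * onRight b = onRight b * onLeft e := by
    rw [hb, onRight_mul, ← mul_assoc, onOuter_mul_onRight_flip2, mul_assoc, mul_assoc,
      (commute_onRight_sum fun i => commute_onLeft he h1 (hX i)).eq]
  constructor
  · calc _ = onLeft b * ((onLeft e * onRight b) * ((onRight e * onLeft b) * onLeft e)) := by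
          simp only [mul_assoc]
      _ = onLeft b * (onRight b * ((onOuter e * onLeft b) * (onOuter e * onLeft e))) := by
          rw [p1, p2]; simp only [mul_assoc]
      _ = _ := by rw [p3]; simp only [mul_assoc]
  · calc _ = onRight b * ((onRight e * onLeft b) * ((onLeft e * onRight b) * onRight e)) := by
          simp only [mul_assoc]
      _ = onRight b * (onLeft b * ((onOuter e * onRight b) * (onOuter e * onRight e))) := by
          rw [p1, p2]; simp only [mul_assoc]
      _ = _ := by rw [p4]; simp only [mul_assoc]

end Passing

section Ideals

variable {V : Type*} [AddCommGroup V] [Module A V]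

/-- All values of the endomorphism lie in `J • ⊤`. -/
def ValuesIn (J : Ideal A) (T : Module.End A V) : Prop :=
  ∀ v, T v ∈ (J • ⊤ : Submodule A V)

lemma ValuesIn.mul_right {J : Ideal A} {T : Module.End A V} (hT : ValuesIn J T)
    (U : Module.End A V) : ValuesIn J (T * U) := fun v => hT (U v)

lemma map_mem_smul_top {V' : Type*} [AddCommGroup V'] [Module A V'] {J : Ideal A}
    (U : V →ₗ[A] V') {v : V} (hv : v ∈ (J • ⊤ : Submodule A V)) :
    U v ∈ (J • ⊤ : Submodule A V') := by
  have h : U v ∈ (J • ⊤ : Submodule A V).map U := Submodule.mem_map_of_mem hv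
  rw [Submodule.map_smul''] at h
  exact Submodule.smul_mono le_rfl le_top h

lemma ValuesIn.mul_left {J : Ideal A} {T : Module.End A V} (hT : ValuesIn J T)
    (U : Module.End A V) : ValuesIn J (U * T) := fun v => map_mem_smul_top U (hT v)

lemma ValuesIn.mul_eq_zero {J J' : Ideal A} (h : J * J' = ⊥) {T U : Module.End A V}
    (hT : ValuesIn J T) (hU : ValuesIn J' U) : T * U = 0 := by
  ext v
  have h1 : T (U v) ∈ (J' • ⊤ : Submodule A V).map T := Submodule.mem_map_of_mem (hU v)
  have h2 : (⊤ : Submodule A V).map T ≤ J • ⊤ := by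
    rintro _ ⟨w, _, rfl⟩
    exact hT w
  rw [Submodule.map_smul''] at h1
  have h3 := Submodule.smul_mono (le_refl J') h2 h1
  rw [← smul_assoc, smul_eq_mul, mul_comm, h] at h3
  simpa using h3

lemma ValuesIn.onLeft {J : Ideal A} {T : Module.End A (M ⊗[A] M)} (hT : ValuesIn J T) :
    ValuesIn J (onLeft T) := by
  intro v
  induction v using TensorProduct.induction_on with
  | zero => simp
  | tmul t z =>
    exact map_mem_smul_top ((TensorProduct.mk A (M ⊗[A] M) M).flip z) (hT t)
  | add a b ha hb => rw [map_add]; exact add_mem ha hb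

lemma ValuesIn.onRight {J : Ideal A} {T : Module.End A (M ⊗[A] M)} (hT : ValuesIn J T) :
    ValuesIn J (onRight T) := by
  intro v
  have h : ∀ w : M ⊗[A] (M ⊗[A] M), LinearMap.lTensor M T w ∈
      (J • ⊤ : Submodule A (M ⊗[A] (M ⊗[A] M))) := by
    intro w
    induction w using TensorProduct.induction_on with
    | zero => simp
    | tmul z t => exact map_mem_smul_top (TensorProduct.mk A M (M ⊗[A] M) z) (hT t)
    | add a b ha hb => rw [map_add]; exact add_mem ha hb
  exact map_mem_smul_top (TensorProduct.assoc A M M M).symm.toLinearMap (h _)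

variable {I J : Ideal A}

lemma ValuesIn.mul_of_sub_one (hIJ : I * J = ⊥) {G U : Module.End A V} (hG : ValuesIn I G)
    (hU : ValuesIn J (U - 1)) : G * U = G := by
  have h := hG.mul_eq_zero hIJ hU
  rwa [mul_sub, mul_one, sub_eq_zero] at h

lemma ValuesIn.of_sub_one_mul (hIJ : I * J = ⊥) {G U : Module.End A V} (hG : ValuesIn I G)
    (hU : ValuesIn J (U - 1)) : U * G = G := by
  have h := hU.mul_eq_zero (mul_comm I J ▸ hIJ) hG
  rwa [sub_mul, one_mul, sub_eq_zero] at h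

/-- First-order expansion of a threefold product around `1`. -/
lemma expand_three (hIJ : I * J = ⊥) {a b d e₁ e₂ e₃ g₁ g₂ g₃ : Module.End A V}
    (he₁ : ValuesIn J (e₁ - 1)) (he₂ : ValuesIn J (e₂ - 1))
    (hf₂ : ValuesIn J (e₂ + g₂ - 1)) (hf₃ : ValuesIn J (e₃ + g₃ - 1))
    (hg₁ : ValuesIn I g₁) (hg₂ : ValuesIn I g₂) (hg₃ : ValuesIn I g₃) :
    (a * (e₁ + g₁)) * ((b * (e₂ + g₂)) * (d * (e₃ + g₃))) =
      (a * e₁) * ((b * e₂) * (d * e₃)) +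
        (a * (g₁ * (b * d)) + a * (b * (g₂ * d)) + a * (b * (d * g₃))) := by
  have s1 : g₁ * (b * ((e₂ + g₂) * (d * (e₃ + g₃)))) = g₁ * (b * d) := by
    have h2 := (hg₁.mul_right b).mul_of_sub_one hIJ hf₂
    have h3 := (hg₁.mul_right (b * d)).mul_of_sub_one hIJ hf₃
    simp only [mul_assoc] at h2 h3
    calc _ = (g₁ * (b * (e₂ + g₂))) * (d * (e₃ + g₃)) := by simp only [mul_assoc]
      _ = _ := by rw [h2, mul_assoc, h3]
  have s2 : e₁ * (b * (g₂ * (d * (e₃ + g₃)))) = b * (g₂ * d) := by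
    have h2 := (hg₂.mul_right d).mul_of_sub_one hIJ hf₃
    have h3 := ((hg₂.mul_right d).mul_left b).of_sub_one_mul hIJ he₁
    simp only [mul_assoc] at h2 h3
    rw [h2, h3]
  have s3 : e₁ * (b * (e₂ * (d * g₃))) = b * (d * g₃) := by
    have h2 := (hg₃.mul_left d).of_sub_one_mul hIJ he₂
    have h3 := ((hg₃.mul_left d).mul_left b).of_sub_one_mul hIJ he₁
    rw [h2, h3]
  have key : (a * (e₁ + g₁)) * ((b * (e₂ + g₂)) * (d * (e₃ + g₃))) =
      (a * e₁) * ((b * e₂) * (d * e₃)) +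
        (a * (g₁ * (b * ((e₂ + g₂) * (d * (e₃ + g₃))))) +
          a * (e₁ * (b * (g₂ * (d * (e₃ + g₃))))) + a * (e₁ * (b * (e₂ * (d * g₃))))) := by
    noncomm_ring
  rw [key, s1, s2, s3]

end Ideals

end Braids

section FreeModules

local instance {A Q : Type*} [CommRing A] : AddCommGroup ((Q →₀ A) ⊗[A] (Q →₀ A)) :=
  TensorProduct.addCommGroup

local instance {A Q : Type*} [CommRing A] :
    AddCommGroup (((Q →₀ A) ⊗[A] (Q →₀ A)) ⊗[A] (Q →₀ A)) :=
  TensorProduct.addCommGroup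

section Coordinates

variable {A Q : Type*} [CommRing A]

/-- The basis vector of `AQ ⊗ AQ` indexed by `(x, y)`. -/
def basis2 (A : Type*) [CommRing A] {Q : Type*} (x y : Q) : (Q →₀ A) ⊗[A] (Q →₀ A) :=
  Finsupp.single x 1 ⊗ₜ Finsupp.single y 1

/-- The basis vector of `AQ ⊗ AQ ⊗ AQ` indexed by `(x, y, z)`. -/
def basis3 (A : Type*) [CommRing A] {Q : Type*} (x y z : Q) :
    ((Q →₀ A) ⊗[A] (Q →₀ A)) ⊗[A] (Q →₀ A) :=
  basis2 A x y ⊗ₜ Finsupp.single z 1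

/-- The coordinates on `AQ ⊗ AQ`. -/
def coord2 (p q : Q) : (Q →₀ A) ⊗[A] (Q →₀ A) →ₗ[A] A :=
  LinearMap.mul' A A ∘ₗ TensorProduct.map (Finsupp.lapply p) (Finsupp.lapply q)

/-- The coordinates on `AQ ⊗ AQ ⊗ AQ`. -/
def coord3 (p q r : Q) : ((Q →₀ A) ⊗[A] (Q →₀ A)) ⊗[A] (Q →₀ A) →ₗ[A] A :=
  LinearMap.mul' A A ∘ₗ TensorProduct.map (coord2 p q) (Finsupp.lapply r)

lemma coord2_tmul (p q : Q) (v w : Q →₀ A) : coord2 p q (v ⊗ₜ[A] w) = v p * w q := by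
  simp [coord2]

lemma coord3_tmul (p q r : Q) (t : (Q →₀ A) ⊗[A] (Q →₀ A)) (w : Q →₀ A) :
    coord3 p q r (t ⊗ₜ[A] w) = coord2 p q t * w r := by
  simp [coord3]

lemma coord3_assoc_symm (p q r : Q) (v : Q →₀ A) (t : (Q →₀ A) ⊗[A] (Q →₀ A)) :
    coord3 p q r ((TensorProduct.assoc A _ _ _).symm (v ⊗ₜ[A] t)) = v p * coord2 q r t := by
  induction t using TensorProduct.induction_on with
  | zero => simp
  | tmul y z => simp [coord3_tmul, coord2_tmul, mul_assoc]
  | add a b ha hb => simp only [TensorProduct.tmul_add, map_add, ha, hb, mul_add]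

lemma finsuppTensorFinsupp'_apply_eq (t : (Q →₀ A) ⊗[A] (Q →₀ A)) (p q : Q) :
    finsuppTensorFinsupp' A Q Q t (p, q) = coord2 p q t := by
  induction t using TensorProduct.induction_on with
  | zero => simp
  | tmul y z => simp [coord2_tmul]
  | add a b ha hb => simp only [map_add, Finsupp.add_apply, ha, hb]

lemma coord2_ext {s t : (Q →₀ A) ⊗[A] (Q →₀ A)} (h : ∀ p q, coord2 p q s = coord2 p q t) :
    s = t := by
  apply (finsuppTensorFinsupp' A Q Q).injective
  ext ⟨p, q⟩
  rw [finsuppTensorFinsupp'_apply_eq, finsuppTensorFinsupp'_apply_eq, h]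

lemma basis2_ext {V : Type*} [AddCommMonoid V] [Module A V]
    {f g : (Q →₀ A) ⊗[A] (Q →₀ A) →ₗ[A] V}
    (h : ∀ x y, f (basis2 A x y) = g (basis2 A x y)) : f = g := by
  ext x y
  simpa [basis2] using h x y

open scoped Classical in
lemma coord2_basis2 (p q x y : Q) :
    coord2 p q (basis2 A x y) = (if x = p then 1 else 0) * (if y = q then 1 else 0) := by
  simp [basis2, coord2_tmul, Finsupp.single_apply]

/-- The matrix entries of an endomorphism of `AQ ⊗ AQ`. -/
def entries (f : Module.End A ((Q →₀ A) ⊗[A] (Q →₀ A))) (x y p q : Q) : A :=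
  coord2 p q (f (basis2 A x y))

lemma mat2_eq_entries (f : Module.End A ((Q →₀ A) ⊗[A] (Q →₀ A))) (x y p q : Q) :
    mat2 A f (x, y) (p, q) = entries f x y p q := by
  rw [mat2, finsuppTensorFinsupp'_apply_eq,
    finsuppTensorFinsupp'_symm_single_eq_single_one_tmul, entries, basis2]

lemma entries_add (f g : Module.End A ((Q →₀ A) ⊗[A] (Q →₀ A))) :
    entries (f + g) = entries f + entries g := by
  ext x y p q
  simp [entries]

lemma entries_sub (f g : Module.End A ((Q →₀ A) ⊗[A] (Q →₀ A))) :
    entries (f - g) = entries f - entries g := by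
  ext x y p q
  simp [entries]

open scoped Classical in
lemma entries_one (x y p q : Q) :
    entries (1 : Module.End A ((Q →₀ A) ⊗[A] (Q →₀ A))) x y p q =
      (if x = p then 1 else 0) * (if y = q then 1 else 0) :=
  coord2_basis2 p q x y

open scoped Classical in
lemma mat2_sub_ite (f : Module.End A ((Q →₀ A) ⊗[A] (Q →₀ A))) (x y p q : Q) :
    entries (f - 1) x y p q = mat2 A f (x, y) (p, q) - if (x, y) = (p, q) then 1 else 0 := by
  rw [entries_sub, mat2_eq_entries]
  simp only [Pi.sub_apply, entries_one, ite_zero_mul_ite_zero, one_mul, Prod.mk.injEq]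

lemma finite_entries (f : Module.End A ((Q →₀ A) ⊗[A] (Q →₀ A))) (x y : Q) :
    {t : Q × Q | entries f x y t.1 t.2 ≠ 0}.Finite := by
  refine (finsuppTensorFinsupp' A Q Q (f (basis2 A x y))).support.finite_toSet.subset ?_
  rintro ⟨p, q⟩ h
  simpa [finsuppTensorFinsupp'_apply_eq, entries] using h

lemma exists_entries_eq (g : Q → Q → Q → Q → A)
    (hg : ∀ x y, {t : Q × Q | g x y t.1 t.2 ≠ 0}.Finite) :
    ∃ f : Module.End A ((Q →₀ A) ⊗[A] (Q →₀ A)), entries f = g := by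
  refine ⟨(finsuppTensorFinsupp' A Q Q).symm.toLinearMap ∘ₗ
    (Finsupp.linearCombination A fun s : Q × Q => Finsupp.ofSupportFinite
      (fun t : Q × Q => g s.1 s.2 t.1 t.2) (hg s.1 s.2)) ∘ₗ
    (finsuppTensorFinsupp' A Q Q).toLinearMap, ?_⟩
  ext x y p q
  rw [entries, ← finsuppTensorFinsupp'_apply_eq]
  simp [basis2]
  rfl

lemma exists_apply_single_eq {I : Ideal A} {a : Q → Q → A} (ha : YBRack.IsMat I a) :
    ∃ N : Module.End A (Q →₀ A), ∀ x p, N (Finsupp.single x 1) p = a x p :=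
  ⟨Finsupp.linearCombination A fun x => Finsupp.ofSupportFinite (a x) (ha.2 x), fun x p => by
    simp [Finsupp.ofSupportFinite_coe]⟩

lemma mem_smul_top_of_apply_mem {ι : Type*} {J : Ideal A} {w : ι →₀ A} (h : ∀ i, w i ∈ J) :
    w ∈ (J • ⊤ : Submodule A (ι →₀ A)) := by
  rw [← Finsupp.sum_single w]
  refine sum_mem fun i _ => ?_
  rw [← mul_one (w i), ← smul_eq_mul, ← Finsupp.smul_single]
  exact Submodule.smul_mem_smul (h i) trivial

lemma valuesIn_of_apply_single {ι : Type*} {J : Ideal A} {T : Module.End A (ι →₀ A)}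
    (h : ∀ x p, T (Finsupp.single x 1) p ∈ J) : ValuesIn J T := by
  intro v
  induction v using Finsupp.induction_linear with
  | zero => simp
  | add v w hv hw => rw [map_add]; exact add_mem hv hw
  | single x c =>
    rw [← mul_one c, ← smul_eq_mul, ← Finsupp.smul_single, map_smul]
    exact Submodule.smul_mem _ _ (mem_smul_top_of_apply_mem (h x))

lemma valuesIn_of_entries {J : Ideal A} {T : Module.End A ((Q →₀ A) ⊗[A] (Q →₀ A))}
    (h : ∀ x y p q, entries T x y p q ∈ J) : ValuesIn J T := by
  intro v
  let E := finsuppTensorFinsupp' A Q Q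
  have hT : ValuesIn J (E.toLinearMap ∘ₗ T ∘ₗ E.symm.toLinearMap) := by
    apply valuesIn_of_apply_single
    rintro ⟨x, y⟩ ⟨p, q⟩
    have hm := h x y p q
    rw [← mat2_eq_entries] at hm
    exact hm
  simpa [E] using map_mem_smul_top E.symm.toLinearMap (hT (E v))

lemma coord3_onLeft_basis3 (g : Module.End A ((Q →₀ A) ⊗[A] (Q →₀ A))) (x y z p q r : Q)
    [Decidable (z = r)] :
    coord3 p q r (onLeft g (basis3 A x y z)) = if z = r then entries g x y p q else 0 := by
  classical
  rw [basis3, onLeft_tmul, coord3_tmul, Finsupp.single_apply, entries]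
  split_ifs <;> simp

lemma coord3_onRight_basis3 (g : Module.End A ((Q →₀ A) ⊗[A] (Q →₀ A))) (x y z p q r : Q)
    [Decidable (x = p)] :
    coord3 p q r (onRight g (basis3 A x y z)) = if x = p then entries g y z q r else 0 := by
  classical
  rw [basis3, basis2, onRight_tmul, coord3_assoc_symm, Finsupp.single_apply, entries, basis2]
  split_ifs <;> simp

end Coordinates

namespace YBRack

variable {Q : Type*} {A : Type*} [CommRing A] (R : YBRack Q)

section Truncation

open scoped Classical in
/-- The action of an inner automorphism on `AQ`, truncated to the elements `x` with
`ϱ(x)` in the given set. -/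
def trunc (A : Type*) [CommRing A] (α : R.Inn) (c : Set (Equiv.Perm Q)) :
    Module.End A (Q →₀ A) :=
  Finsupp.linearCombination A fun x =>
    if R.rho x ∈ c then Finsupp.single ((α : Equiv.Perm Q) x) 1 else 0

open scoped Classical in
lemma trunc_single (α : R.Inn) (c : Set (Equiv.Perm Q)) (x : Q) :
    R.trunc A α c (Finsupp.single x 1) =
      if R.rho x ∈ c then Finsupp.single ((α : Equiv.Perm Q) x) 1 else 0 := by
  simp [trunc]

open scoped Classical in
lemma trunc_apply (α : R.Inn) (c : Set (Equiv.Perm Q)) (w : Q →₀ A) (p : Q) :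
    R.trunc A α c w ((α : Equiv.Perm Q) p) = if R.rho p ∈ c then w p else 0 := by
  induction w using Finsupp.induction_linear with
  | zero => simp
  | add v w hv hw =>
    rw [map_add, Finsupp.add_apply, hv, hw]
    split_ifs <;> simp
  | single x a =>
    rw [← mul_one a, ← smul_eq_mul, ← Finsupp.smul_single, map_smul, trunc_single]
    by_cases hx : x = p
    · subst hx
      split_ifs <;> simp
    · split_ifs <;> simp [hx]

lemma trunc_one_univ : R.trunc A 1 Set.univ = 1 := by
  ext x p
  simp [trunc_single]

/-- The truncated actions of inner automorphisms. -/
def truncs (A : Type*) [CommRing A] : Set (Module.End A (Q →₀ A)) :=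
  {X | ∃ α c, X = R.trunc A α c}

open scoped Classical in
lemma coord2_trunc (α β : R.Inn) (c d : Set (Equiv.Perm Q)) (p q : Q)
    (w : (Q →₀ A) ⊗[A] (Q →₀ A)) :
    coord2 ((α : Equiv.Perm Q) p) ((β : Equiv.Perm Q) q)
        (TensorProduct.map (R.trunc A α c) (R.trunc A β d) w) =
      if R.rho p ∈ c ∧ R.rho q ∈ d then coord2 p q w else 0 := by
  induction w using TensorProduct.induction_on with
  | zero => simp
  | add a b ha hb =>
    simp only [map_add, ha, hb]
    split_ifs <;> simp
  | tmul v w =>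
    rw [TensorProduct.map_tmul, coord2_tmul, coord2_tmul, trunc_apply, trunc_apply]
    by_cases h1 : R.rho p ∈ c <;> by_cases h2 : R.rho q ∈ d <;> simp [h1, h2]

open scoped Classical in
lemma coord3_trunc (α β γ : R.Inn) (b c d : Set (Equiv.Perm Q)) (p q r : Q)
    (w : ((Q →₀ A) ⊗[A] (Q →₀ A)) ⊗[A] (Q →₀ A)) :
    coord3 ((α : Equiv.Perm Q) p) ((β : Equiv.Perm Q) q) ((γ : Equiv.Perm Q) r)
        (TensorProduct.map (TensorProduct.map (R.trunc A α b) (R.trunc A β c))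
          (R.trunc A γ d) w) =
      if R.rho p ∈ b ∧ R.rho q ∈ c ∧ R.rho r ∈ d then coord3 p q r w else 0 := by
  induction w using TensorProduct.induction_on with
  | zero => simp
  | add a b ha hb =>
    simp only [map_add, ha, hb]
    split_ifs <;> simp
  | tmul t w =>
    rw [TensorProduct.map_tmul, coord3_tmul, coord3_tmul, coord2_trunc, trunc_apply]
    by_cases h1 : R.rho p ∈ b <;> by_cases h2 : R.rho q ∈ c <;> by_cases h3 : R.rho r ∈ d <;>
      simp [h1, h2, h3]

open scoped Classical in
lemma map_trunc_basis2 (α β : R.Inn) (c d : Set (Equiv.Perm Q)) (x y : Q) :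
    TensorProduct.map (R.trunc A α c) (R.trunc A β d) (basis2 A x y) =
      if R.rho x ∈ c ∧ R.rho y ∈ d then
        basis2 A ((α : Equiv.Perm Q) x) ((β : Equiv.Perm Q) y) else 0 := by
  rw [basis2, TensorProduct.map_tmul, trunc_single, trunc_single, basis2]
  by_cases h1 : R.rho x ∈ c <;> by_cases h2 : R.rho y ∈ d <;> simp [h1, h2]

lemma map_trunc_basis3 (α β γ : R.Inn) {b c d : Set (Equiv.Perm Q)} {x y z : Q}
    (hx : R.rho x ∈ b) (hy : R.rho y ∈ c) (hz : R.rho z ∈ d) :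
    TensorProduct.map (TensorProduct.map (R.trunc A α b) (R.trunc A β c)) (R.trunc A γ d)
        (basis3 A x y z) =
      basis3 A ((α : Equiv.Perm Q) x) ((β : Equiv.Perm Q) y) ((γ : Equiv.Perm Q) z) := by
  rw [basis3, TensorProduct.map_tmul, map_trunc_basis2, trunc_single, basis3]
  simp [hx, hy, hz]

variable {R}

lemma EntropicMat.commute {e : Module.End A ((Q →₀ A) ⊗[A] (Q →₀ A))}
    (he : R.EntropicMat (entries e)) :
    ∀ X ∈ R.truncs A, ∀ Y ∈ R.truncs A, Commute e (TensorProduct.map X Y) := by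
  classical
  rintro _ ⟨α, c, rfl⟩ _ ⟨β, d, rfl⟩
  refine basis2_ext (V := (Q →₀ A) ⊗[A] (Q →₀ A)) (f := e * _) (g := _ * e) ?_
  intro x y
  apply coord2_ext
  intro p q
  obtain ⟨p, rfl⟩ := (α : Equiv.Perm Q).surjective p
  obtain ⟨q, rfl⟩ := (β : Equiv.Perm Q).surjective q
  rw [Module.End.mul_apply, Module.End.mul_apply, coord2_trunc, map_trunc_basis2]
  have h2 := he.2 x y p q α β
  by_cases H : ¬ R.BEquiv x p ∨ ¬ R.BEquiv y q
  · have h1 := he.1 x y p q H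
    rw [h1] at h2
    rw [entries] at h1 h2
    rw [apply_ite e, apply_ite (coord2 _ _), h1, h2]
    simp
  · push Not at H
    have hx : R.rho x = R.rho p := H.1
    have hy : R.rho y = R.rho q := H.2
    rw [entries, entries] at h2
    rw [hx, hy, apply_ite e, apply_ite (coord2 _ _), h2]
    simp

/-- An operator commuting with the truncated actions of inner automorphisms is quasi-diagonal
and fully equivariant. -/
lemma coord3_of_commute {D : Module.End A (((Q →₀ A) ⊗[A] (Q →₀ A)) ⊗[A] (Q →₀ A))}
    (hD : ∀ X ∈ R.truncs A, ∀ Y ∈ R.truncs A, ∀ Z ∈ R.truncs A,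
      Commute D (TensorProduct.map (TensorProduct.map X Y) Z)) (x y z p q r : Q) :
    ((¬ R.BEquiv x p ∨ ¬ R.BEquiv y q ∨ ¬ R.BEquiv z r) →
      coord3 p q r (D (basis3 A x y z)) = 0) ∧
    ∀ α β γ : R.Inn,
      coord3 ((α : Equiv.Perm Q) p) ((β : Equiv.Perm Q) q) ((γ : Equiv.Perm Q) r)
        (D (basis3 A ((α : Equiv.Perm Q) x) ((β : Equiv.Perm Q) y) ((γ : Equiv.Perm Q) z))) =
      coord3 p q r (D (basis3 A x y z)) := by
  classical
  have key : ∀ (α β γ : R.Inn) (b c d : Set (Equiv.Perm Q)), R.rho x ∈ b → R.rho y ∈ c →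
      R.rho z ∈ d → coord3 ((α : Equiv.Perm Q) p) ((β : Equiv.Perm Q) q) ((γ : Equiv.Perm Q) r)
        (D (basis3 A ((α : Equiv.Perm Q) x) ((β : Equiv.Perm Q) y) ((γ : Equiv.Perm Q) z))) =
      if R.rho p ∈ b ∧ R.rho q ∈ c ∧ R.rho r ∈ d then coord3 p q r (D (basis3 A x y z))
        else 0 := by
    intro α β γ b c d hx hy hz
    have h := (hD _ ⟨α, b, rfl⟩ _ ⟨β, c, rfl⟩ _ ⟨γ, d, rfl⟩).eq
    rw [← map_trunc_basis3 R α β γ hx hy hz, ← coord3_trunc, ← Module.End.mul_apply, h,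
      Module.End.mul_apply]
  refine ⟨fun H => ?_, fun α β γ => ?_⟩
  · have h := key 1 1 1 {R.rho x} {R.rho y} {R.rho z} rfl rfl rfl
    rw [if_neg] at h
    · exact h
    · rintro ⟨h1, h2, h3⟩
      rcases H with H | H | H
      · exact H (Eq.symm h1)
      · exact H (Eq.symm h2)
      · exact H (Eq.symm h3)
  · rw [key α β γ Set.univ Set.univ Set.univ trivial trivial trivial]
    simp

end Truncation

section Braiding

variable (A)

/-- The bijection `(x, y) ↦ (y, x ^ y)` of `Q × Q`. -/
def braidPerm : Equiv.Perm (Q × Q) where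
  toFun t := (t.2, R.act t.1 t.2)
  invFun t := ((R.rho t.1).symm t.2, t.1)
  left_inv t := by
    ext
    · exact (R.rho t.2).symm_apply_apply t.1
    · rfl
  right_inv t := by
    ext
    · rfl
    · exact (R.rho t.1).apply_symm_apply t.2

/-- The Yang-Baxter operator of a rack. -/
def braid : ((Q →₀ A) ⊗[A] (Q →₀ A)) ≃ₗ[A] ((Q →₀ A) ⊗[A] (Q →₀ A)) :=
  finsuppTensorFinsupp' A Q Q ≪≫ₗ Finsupp.domLCongr R.braidPerm ≪≫ₗ
    (finsuppTensorFinsupp' A Q Q).symm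

lemma braid_basis2 (x y : Q) : R.braid A (basis2 A x y) = basis2 A y (R.act x y) := by
  simp [braid, basis2, braidPerm, finsuppTensorFinsupp'_symm_single_eq_single_one_tmul]

variable {A}

lemma coord2_braid (p q : Q) (w : (Q →₀ A) ⊗[A] (Q →₀ A)) :
    coord2 q (R.act p q) (R.braid A w) = coord2 p q w := by
  rw [← finsuppTensorFinsupp'_apply_eq, ← finsuppTensorFinsupp'_apply_eq]
  have h : (q, R.act p q) = R.braidPerm (p, q) := rfl
  simp [h, braid]

lemma coord2_braid_symm (p q : Q) (w : (Q →₀ A) ⊗[A] (Q →₀ A)) :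
    coord2 p q ((R.braid A).symm w) = coord2 q (R.act p q) w := by
  rw [← coord2_braid, LinearEquiv.apply_symm_apply]

/-- `R.braid A` as an endomorphism. -/
def braidEnd (A : Type*) [CommRing A] : Module.End A ((Q →₀ A) ⊗[A] (Q →₀ A)) :=
  (R.braid A).toLinearMap

lemma braidEnd_eq [Fintype R.Inn] : R.braidEnd A = flip2 A (Q →₀ A) *
    ∑ s : R.Inn, TensorProduct.map (R.trunc A s Set.univ)
      (R.trunc A 1 {(s : Equiv.Perm Q)}) := by
  classical
  refine basis2_ext (V := (Q →₀ A) ⊗[A] (Q →₀ A)) ?_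
  intro x y
  rw [Module.End.mul_apply, LinearMap.sum_apply, Finset.sum_eq_single (R.inn y)]
  · rw [map_trunc_basis2, if_pos ⟨trivial, rfl⟩]
    exact R.braid_basis2 A x y
  · intro s _ hs
    rw [map_trunc_basis2, if_neg]
    rintro ⟨-, h⟩
    exact hs (Subtype.ext (Eq.symm h))
  · simp

lemma onLeft_braid_basis3 (x y z : Q) :
    onLeft (R.braidEnd A) (basis3 A x y z) = basis3 A y (R.act x y) z := by
  rw [basis3, onLeft_tmul]
  exact congrArg (· ⊗ₜ[A] Finsupp.single z (1 : A)) (R.braid_basis2 A x y)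

lemma onRight_braid_basis3 (x y z : Q) :
    onRight (R.braidEnd A) (basis3 A x y z) = basis3 A x z (R.act y z) := by
  rw [basis3, basis2, onRight_tmul]
  have h : R.braidEnd A _ = _ := R.braid_basis2 A y z
  rw [basis2] at h
  rw [h]
  rfl

lemma coord3_onLeft_braid (p q r : Q) (w : ((Q →₀ A) ⊗[A] (Q →₀ A)) ⊗[A] (Q →₀ A)) :
    coord3 q (R.act p q) r (onLeft (R.braidEnd A) w) = coord3 p q r w := by
  induction w using TensorProduct.induction_on with
  | zero => simp
  | add a b ha hb => simp only [map_add, ha, hb]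
  | tmul t w =>
    rw [onLeft_tmul, coord3_tmul, coord3_tmul]
    exact congrArg (· * w r) (R.coord2_braid p q t)

lemma coord3_onRight_braid (p q r : Q) (w : ((Q →₀ A) ⊗[A] (Q →₀ A)) ⊗[A] (Q →₀ A)) :
    coord3 p r (R.act q r) (onRight (R.braidEnd A) w) = coord3 p q r w := by
  obtain ⟨w, rfl⟩ := (TensorProduct.assoc A (Q →₀ A) (Q →₀ A) (Q →₀ A)).symm.surjective w
  induction w using TensorProduct.induction_on with
  | zero => simp
  | add a b ha hb => simp only [map_add, ha, hb]
  | tmul v t =>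
    rw [coord3_assoc_symm, onRight]
    simp only [LinearMap.comp_apply, LinearEquiv.coe_coe, LinearEquiv.apply_symm_apply,
      LinearMap.lTensor_tmul, coord3_assoc_symm]
    exact congrArg (v p * ·) (R.coord2_braid q r t)

end Braiding

end YBRack

section Deformations

namespace YBRack

variable {Q : Type*} {A : Type*} [CommRing A] {R : YBRack Q}

/-- First-order part of the Yang-Baxter equation for a deformation of an entropic deformation
`e` of `c_Q`. -/
lemma linYB_entries [Fintype R.Inn] {I J : Ideal A} (hIJ : I * J = ⊥)
    {e g : Module.End A ((Q →₀ A) ⊗[A] (Q →₀ A))}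
    (he : R.EntropicMat (entries e)) (heJ : ValuesIn J (e - 1)) (hgI : ValuesIn I g)
    (hgJ : ValuesIn J (e + g - 1)) (hYB : YBE (R.braidEnd A * (e + g))) (x y z p q r : Q) :
    R.linYB (entries g) x y z p q r = coord3 p q r
      ((onLeft e * (onOuter e * onRight e) - onRight e * (onOuter e * onLeft e))
        (basis3 A x y z)) := by
  have hL : ∀ {h : Module.End A ((Q →₀ A) ⊗[A] (Q →₀ A))}, ValuesIn J (h - 1) →
      ValuesIn J (onLeft h - 1) := by
    intro h hh
    have h1 : onLeft h = onLeft (h - 1) + 1 := by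
      rw [← onLeft_one, ← onLeft_add, sub_add_cancel]
    rw [h1, add_sub_cancel_right]
    exact hh.onLeft
  have hR : ∀ {h : Module.End A ((Q →₀ A) ⊗[A] (Q →₀ A))}, ValuesIn J (h - 1) →
      ValuesIn J (onRight h - 1) := by
    intro h hh
    have h1 : onRight h = onRight (h - 1) + 1 := by
      rw [← onRight_one, ← onRight_add, sub_add_cancel]
    rw [h1, add_sub_cancel_right]
    exact hh.onRight
  have hLe := hL heJ
  have hRe := hR heJ
  have hLf := hL hgJ
  have hRf := hR hgJ
  rw [onLeft_add] at hLf
  rw [onRight_add] at hRf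
  have hmain := (yBE_iff _).1 hYB
  simp only [onLeft_mul, onRight_mul, onLeft_add, onRight_add] at hmain
  rw [expand_three hIJ hLe hRe hRf hLf hgI.onLeft hgI.onRight hgI.onLeft,
    expand_three hIJ hRe hLe hLf hRf hgI.onRight hgI.onLeft hgI.onRight] at hmain
  have h1 : (1 : Module.End A (Q →₀ A)) ∈ R.truncs A := ⟨1, Set.univ, R.trunc_one_univ.symm⟩
  obtain ⟨b1, b2⟩ := braid_mul he.commute h1 (fun s => ⟨s, Set.univ, rfl⟩)
    (fun s => ⟨1, {(s : Equiv.Perm Q)}, rfl⟩) R.braidEnd_eq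
  rw [b1, b2] at hmain
  have h := congrArg (fun T => coord3 r (R.act q r) (R.act (R.act p q) r) (T (basis3 A x y z)))
    hmain
  have hr : ∀ w, coord3 r (R.act q r) (R.act (R.act p q) r) (onRight (R.braidEnd A) w) =
      coord3 r (R.act p r) (R.act q r) w := fun w => by
    rw [R.self_distrib, coord3_onRight_braid]
  classical
  simp only [LinearMap.add_apply, map_add, Module.End.mul_apply, coord3_onLeft_braid,
    coord3_onRight_braid, hr, onLeft_braid_basis3, onRight_braid_basis3, coord3_onLeft_basis3,
    coord3_onRight_basis3] at h
  rw [LinearMap.sub_apply, map_sub]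
  simp only [Module.End.mul_apply, linYB_apply]
  have hz : (if z = r then entries g x y p q - entries g (R.act x z) (R.act y z) (R.act p z)
      (R.act q z) else 0) = (if z = r then entries g x y p q else 0) -
      (if z = r then entries g (R.act x z) (R.act y z) (R.act p r) (R.act q r) else 0) := by
    split_ifs with hzr
    · rw [hzr]
    · rw [sub_zero]
  have hy : (if y = q then entries g (R.act x y) z (R.act p y) r else 0) =
      (if y = q then entries g (R.act x y) z (R.act p q) r else 0) := by
    split_ifs with hyq
    · rw [hyq]
    · rfl
  rw [hz, hy, sub_mul, ite_mul, ite_mul, one_mul, zero_mul]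
  linear_combination h

lemma exists_entropicMat_sub_mem [Fintype R.Inn] (hunit : IsUnit ((Fintype.card R.Inn : A)))
    {I : Ideal A} {f : Module.End A ((Q →₀ A) ⊗[A] (Q →₀ A))}
    (hqd : ∀ x y u v : Q, (¬ R.BEquiv x u ∨ ¬ R.BEquiv y v) → entries f x y u v ∈ I)
    (heqv : ∀ (x y u v : Q) (α β : R.Inn),
      entries f x y u v - entries f ((α : Equiv.Perm Q) x) ((β : Equiv.Perm Q) y)
        ((α : Equiv.Perm Q) u) ((β : Equiv.Perm Q) v) ∈ I) :
    ∃ e : Module.End A ((Q →₀ A) ⊗[A] (Q →₀ A)), R.EntropicMat (entries e) ∧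
      ∀ x y u v, entries f x y u v - entries e x y u v ∈ I := by
  classical
  obtain ⟨c, hc⟩ := hunit.exists_left_inv
  let s : Q → Q → Q → Q → A := fun x y u v => ∑ t : R.Inn × R.Inn,
    entries f ((t.1 : Equiv.Perm Q) x) ((t.2 : Equiv.Perm Q) y)
      ((t.1 : Equiv.Perm Q) u) ((t.2 : Equiv.Perm Q) v)
  have hs : ∀ (x y u v : Q) (α β : R.Inn), s ((α : Equiv.Perm Q) x) ((β : Equiv.Perm Q) y)
      ((α : Equiv.Perm Q) u) ((β : Equiv.Perm Q) v) = s x y u v := fun x y u v α β =>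
    Fintype.sum_equiv (Equiv.mulRight ((α, β) : R.Inn × R.Inn)) _ _ fun t => rfl
  let g : Q → Q → Q → Q → A := fun x y u v =>
    if R.BEquiv x u ∧ R.BEquiv y v then c * c * s x y u v else 0
  have hg : ∀ x y, {t : Q × Q | g x y t.1 t.2 ≠ 0}.Finite := by
    intro x y
    refine (Set.finite_iUnion fun t : R.Inn × R.Inn => (finite_entries f
      ((t.1 : Equiv.Perm Q) x) ((t.2 : Equiv.Perm Q) y)).preimage
      ((Equiv.prodCongr (t.1 : Equiv.Perm Q) (t.2 : Equiv.Perm Q)).injective.injOn)).subset ?_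
    rintro ⟨u, v⟩ h
    by_contra h'
    refine h ?_
    have h0 : s x y u v = 0 := Finset.sum_eq_zero fun t _ => by
      by_contra ht
      exact h' (Set.mem_iUnion.2 ⟨t, ht⟩)
    simp [g, h0]
  obtain ⟨e, he⟩ := exists_entries_eq g hg
  refine ⟨e, he ▸ ⟨fun x y u v H => if_neg fun h => ?_, fun x y u v α β => ?_⟩,
    fun x y u v => ?_⟩
  · exact H.elim (fun h' => h' h.1) fun h' => h' h.2
  · simp only [g, hs, bequiv_inn]
  · rw [he]
    by_cases H : R.BEquiv x u ∧ R.BEquiv y v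
    · have h1 : entries f x y u v - g x y u v = c * c * ∑ t : R.Inn × R.Inn,
          (entries f x y u v - entries f ((t.1 : Equiv.Perm Q) x) ((t.2 : Equiv.Perm Q) y)
            ((t.1 : Equiv.Perm Q) u) ((t.2 : Equiv.Perm Q) v)) := by
        simp only [g, if_pos H, Finset.sum_sub_distrib, Finset.sum_const, Finset.card_univ,
          Fintype.card_prod, nsmul_eq_mul, Nat.cast_mul, s]
        linear_combination (-c * (Fintype.card R.Inn) - 1) * entries f x y u v * hc
      rw [h1]
      exact I.mul_mem_left _ (sum_mem fun t _ => heqv x y u v t.1 t.2)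
    · simp only [g, if_neg H, sub_zero]
      exact hqd x y u v (not_and_or.1 H)

lemma linYB_entries_eq_zero [Fintype R.Inn] (hunit : IsUnit ((Fintype.card R.Inn : A)))
    {I J : Ideal A} (hIJ : I * J = ⊥)
    {e g : Module.End A ((Q →₀ A) ⊗[A] (Q →₀ A))}
    (he : R.EntropicMat (entries e)) (heJ : ValuesIn J (e - 1)) (hgI : ValuesIn I g)
    (hgJ : ValuesIn J (e + g - 1)) (hYB : YBE (R.braidEnd A * (e + g))) :
    R.linYB (entries g) = 0 := by
  have h := linYB_entries hIJ he heJ hgI hgJ hYB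
  have hD : ∀ X ∈ R.truncs A, ∀ Y ∈ R.truncs A, ∀ Z ∈ R.truncs A,
      Commute (onLeft e * (onOuter e * onRight e) - onRight e * (onOuter e * onLeft e))
        (TensorProduct.map (TensorProduct.map X Y) Z) := by
    intro X hX Y hY Z hZ
    have hl := commute_onLeft (Z := Z) he.commute hX hY
    have hr := commute_onRight (X := X) he.commute hY hZ
    have ho := commute_onOuter (Y := Y) he.commute hX hZ
    exact (hl.mul_left (ho.mul_left hr)).sub_left (hr.mul_left (ho.mul_left hl))
  refine R.linYB_eq_zero hunit (fun x y z p q r H => ?_) fun x y z p q r α β γ => ?_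
  · rw [h]
    exact (coord3_of_commute hD x y z p q r).1 H
  · rw [h, h]
    exact (coord3_of_commute hD x y z p q r).2 α β γ

open scoped Classical in
lemma entries_map_add_map (N : Module.End A (Q →₀ A)) (x y p q : Q) :
    entries (TensorProduct.map N 1 + TensorProduct.map 1 N) x y p q =
      N (Finsupp.single x 1) p * (if y = q then 1 else 0) +
        (if x = p then 1 else 0) * N (Finsupp.single y 1) q := by
  simp [entries, basis2, coord2_tmul, Finsupp.single_apply]

lemma entries_mul_braidEnd (T : Module.End A ((Q →₀ A) ⊗[A] (Q →₀ A))) (x y p q : Q) :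
    entries (((R.braid A).symm.toLinearMap : Module.End A ((Q →₀ A) ⊗[A] (Q →₀ A))) *
      T * R.braidEnd A) x y p q = entries T y (R.act x y) q (R.act p q) := by
  rw [entries, entries, ← R.braid_basis2 A x y, ← coord2_braid_symm]
  rfl

lemma exists_linearEquiv_eq_one_add {V : Type*} [AddCommGroup V] [Module A V]
    {N : Module.End A V} (h : N * N = 0) : ∃ α : V ≃ₗ[A] V, α.toLinearMap = 1 + N := by
  refine ⟨LinearEquiv.ofLinearMap (1 + N) (1 - N) ?_ ?_, rfl⟩
  · change (1 + N) * (1 - N) = 1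
    rw [mul_sub, mul_one, add_mul, one_mul, h, add_zero, add_sub_cancel_right]
  · change (1 - N) * (1 + N) = 1
    rw [mul_add, mul_one, sub_mul, one_mul, h, sub_zero, sub_add_cancel]

lemma mul_one_add_eq_of_mul_eq {S : Type*} [Ring S] {b c f B : S} (hbc : b * c = 1)
    (h1 : f * B = B) (h2 : B * b * f = B * b) (h3 : B * b * B = 0) (h4 : B * B = 0) :
    b * f * (1 + B) = (1 + B) * (b * (f + (B - c * B * b))) := by
  calc b * f * (1 + B) = b * f + b * (f * B) := by noncomm_ring
    _ = b * f + b * B + B * b * f - (b * c) * B * b + B * b * B - B * (b * c) * B * b := by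
      rw [h1, h2, h3, hbc, mul_one, h4]
      simp
    _ = _ := by noncomm_ring

/-- An entropic deformation modulo `I` is equivalent to an entropic deformation. -/
lemma exists_conj_entropicMat [Fintype R.Inn] (hunit : IsUnit ((Fintype.card R.Inn : A)))
    {I J : Ideal A} (hIJ : I * J = ⊥) (hle : I ≤ J)
    {f : Module.End A ((Q →₀ A) ⊗[A] (Q →₀ A))}
    (hf : ∀ x y u v, entries (f - 1) x y u v ∈ J)
    (hqd : ∀ x y u v : Q, (¬ R.BEquiv x u ∨ ¬ R.BEquiv y v) → entries f x y u v ∈ I)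
    (heqv : ∀ (x y u v : Q) (α β : R.Inn),
      entries f x y u v - entries f ((α : Equiv.Perm Q) x) ((β : Equiv.Perm Q) y)
        ((α : Equiv.Perm Q) u) ((β : Equiv.Perm Q) v) ∈ I)
    (hYB : YBE (R.braidEnd A * f)) :
    ∃ (N : Module.End A (Q →₀ A)) (f' : Module.End A ((Q →₀ A) ⊗[A] (Q →₀ A))),
      (∀ x p, N (Finsupp.single x 1) p ∈ I) ∧ N * N = 0 ∧ R.EntropicMat (entries f') ∧
      (∀ x y u v, entries (f' - 1) x y u v ∈ J) ∧
      R.braidEnd A * f * TensorProduct.map (1 + N) (1 + N) =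
        TensorProduct.map (1 + N) (1 + N) * (R.braidEnd A * f') := by
  classical
  obtain ⟨e, he, hfe⟩ := exists_entropicMat_sub_mem hunit hqd heqv
  obtain ⟨g, rfl⟩ : ∃ g, f = e + g := ⟨f - e, by abel⟩
  have hgI : ∀ x y u v, entries g x y u v ∈ I := fun x y u v => by
    have h := hfe x y u v
    rw [entries_add] at h
    simpa using h
  have hfJ := valuesIn_of_entries hf
  have heJ : ValuesIn J (e - 1) := valuesIn_of_entries fun x y u v => by
    have h : e - 1 = (e + g - 1) - g := by abel
    rw [h, entries_sub]
    exact sub_mem (hf x y u v) (hle (hgI x y u v))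
  have hlin := linYB_entries_eq_zero hunit hIJ he heJ (valuesIn_of_entries hgI) hfJ hYB
  obtain ⟨a, ha, hga⟩ := R.exists_entropicMat hunit hgI (finite_entries g) hlin
  obtain ⟨N, hN⟩ := exists_apply_single_eq ha
  have hII : ∀ {s t : A}, s ∈ I → t ∈ I → s * t = 0 := fun {s t} hs ht => by
    have h := Ideal.mul_mem_mul hs (hle ht)
    rwa [hIJ] at h
  have hNI : ∀ x p, N (Finsupp.single x 1) p ∈ I := fun x p => hN x p ▸ ha.1 x p
  have hI2 : I * I = ⊥ := le_bot_iff.1 (hIJ ▸ Ideal.mul_mono_right hle)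
  have hNv := valuesIn_of_apply_single hNI
  have hNN : TensorProduct.map N N = 0 := by
    refine basis2_ext fun x y => coord2_ext fun p q => ?_
    rw [basis2, TensorProduct.map_tmul, coord2_tmul, hII (hNI x p) (hNI y q)]
    simp
  let B : Module.End A ((Q →₀ A) ⊗[A] (Q →₀ A)) :=
    TensorProduct.map N 1 + TensorProduct.map 1 N
  let C : Module.End A ((Q →₀ A) ⊗[A] (Q →₀ A)) := (R.braid A).symm.toLinearMap
  have hC : R.braidEnd A * C = 1 :=
    LinearMap.ext (R.braid A).apply_symm_apply
  have hB : TensorProduct.map (1 + N) (1 + N) = 1 + B := by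
    rw [TensorProduct.map_add_left, TensorProduct.map_add_right, TensorProduct.map_add_right, hNN,
      TensorProduct.map_one]
    simp only [B]
    abel
  have hBe : ∀ x y p q, entries B x y p q = a x p * (if y = q then 1 else 0) +
      (if x = p then 1 else 0) * a y q := fun x y p q => by
    rw [entries_map_add_map, hN, hN]
  have hBI : ∀ x y p q, entries B x y p q ∈ I := fun x y p q => by
    rw [hBe]
    exact add_mem (I.mul_mem_right _ (ha.1 x p)) (I.mul_mem_left _ (ha.1 y q))
  have hBv := valuesIn_of_entries hBI
  have hent : entries (B - C * B * R.braidEnd A) = R.coboundary a := by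
    ext x y p q
    rw [entries_sub, coboundary_apply]
    simp only [Pi.sub_apply]
    rw [hBe, entries_mul_braidEnd, hBe]
    by_cases h : y = q
    · simp only [if_pos h]
      rw [h]
      ring
    · simp only [if_neg h]
      ring
  refine ⟨N, e + g + (B - C * B * R.braidEnd A), hNI, hNv.mul_eq_zero hI2 hNv, ?_, ?_, ?_⟩
  · rw [add_assoc, entries_add, entries_add, hent]
    exact he.add hga
  · intro x y u v
    have h : e + g + (B - C * B * R.braidEnd A) - 1 =
        (e + g - 1) + (B - C * B * R.braidEnd A) := by abel
    rw [h, entries_add (e + g - 1), entries_sub B, Pi.add_apply, Pi.add_apply, Pi.add_apply,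
      Pi.add_apply, Pi.sub_apply, Pi.sub_apply, Pi.sub_apply, Pi.sub_apply]
    refine add_mem (hf x y u v) (hle (sub_mem (hBI x y u v) ?_))
    rw [entries_mul_braidEnd]
    exact hBI _ _ _ _
  · have h1 : (e + g) * B = B := hBv.of_sub_one_mul hIJ hfJ
    have h2 : B * R.braidEnd A * (e + g) = B * R.braidEnd A :=
      (hBv.mul_right _).mul_of_sub_one hIJ hfJ
    have h3 : B * R.braidEnd A * B = 0 := (hBv.mul_right _).mul_eq_zero hI2 hBv
    have h4 : B * B = 0 := hBv.mul_eq_zero hI2 hBv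
    rw [hB]
    exact mul_one_add_eq_of_mul_eq hC h1 h2 h3 h4

end YBRack

end Deformations

end FreeModules

open scoped Classical in
/-- (Lemma: the inductive step.) Assume `m^{n+1} = 0`, `n ≥ 1`,
and `|Inn(Q)|` invertible in `A`.  If `c = c_Q ∘ f` is a Yang–Baxter operator with
`f ≡ id mod m` and `f` entropic modulo `m^n`, then `c` is conjugate by some
`α ⊗ α`, `α ≡ id mod m^n`, to an entropic deformation of `c_Q`. -/
theorem inductive_step
    {A Q : Type*} [CommRing A] (R : YBRack Q)
    [Fintype R.Inn] (hunit : IsUnit ((Fintype.card R.Inn : A)))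
    (m : Ideal A) {n : ℕ} (hn : 1 ≤ n) (hmn : m ^ (n+1) = ⊥)
    (cQ : ((Q →₀ A) ⊗[A] (Q →₀ A)) →ₗ[A] ((Q →₀ A) ⊗[A] (Q →₀ A)))
    (hcQ : ∀ x y : Q,
      cQ (Finsupp.single x (1 : A) ⊗ₜ[A] Finsupp.single y (1 : A))
        = Finsupp.single y (1 : A) ⊗ₜ[A] Finsupp.single (R.act x y) (1 : A))
    (f : ((Q →₀ A) ⊗[A] (Q →₀ A)) →ₗ[A] ((Q →₀ A) ⊗[A] (Q →₀ A)))
    (hfbij : Function.Bijective f)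
    (hfmod : ∀ p q : Q × Q, mat2 A f p q - (if p = q then 1 else 0) ∈ m)
    (hqd : ∀ x y u v : Q, (¬ R.BEquiv x u ∨ ¬ R.BEquiv y v) → mat2 A f (x, y) (u, v) ∈ m ^ n)
    (heqv : ∀ (x y u v : Q) (α β : R.Inn),
      mat2 A f (x, y) (u, v)
        - mat2 A f ((α : Equiv.Perm Q) x, (β : Equiv.Perm Q) y)
            ((α : Equiv.Perm Q) u, (β : Equiv.Perm Q) v) ∈ m ^ n)
    (hYB : YBE (cQ ∘ₗ f)) :
    ∃ α : (Q →₀ A) ≃ₗ[A] (Q →₀ A),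
      (∀ x u : Q, (α (Finsupp.single x 1)) u - (if x = u then 1 else 0) ∈ m ^ n) ∧
      ∃ f' : ((Q →₀ A) ⊗[A] (Q →₀ A)) →ₗ[A] ((Q →₀ A) ⊗[A] (Q →₀ A)),
        Entropic2 R A f' ∧ Function.Bijective f' ∧
        (∀ p q : Q × Q, mat2 A f' p q - (if p = q then 1 else 0) ∈ m) ∧
        (TensorProduct.congr α α).symm.toLinearMap ∘ₗ (cQ ∘ₗ f) ∘ₗ
            (TensorProduct.congr α α).toLinearMap
          = cQ ∘ₗ f' := by
  have hc : cQ = R.braidEnd A :=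
    basis2_ext (f := cQ) (g := (R.braid A).toLinearMap)
      fun x y => (hcQ x y).trans (R.braid_basis2 A x y).symm
  have hle : m ^ n ≤ m := Ideal.pow_le_self (Nat.one_le_iff_ne_zero.1 hn)
  subst hc
  obtain ⟨N, f', hN, hNN, he, hJ, hconj⟩ := YBRack.exists_conj_entropicMat (f := f) hunit
    ((pow_succ m n).symm.trans hmn) hle
    (fun x y u v => (mat2_sub_ite f x y u v).symm ▸ hfmod (x, y) (u, v))
    (fun x y u v h => mat2_eq_entries f x y u v ▸ hqd x y u v h)
    (fun x y u v α β => by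
      rw [← mat2_eq_entries, ← mat2_eq_entries]
      exact heqv x y u v α β) hYB
  obtain ⟨α, hN'⟩ := YBRack.exists_linearEquiv_eq_one_add (V := Q →₀ A) (N := N) hNN
  have hα : (TensorProduct.congr α α).symm.toLinearMap ∘ₗ (R.braidEnd A ∘ₗ f) ∘ₗ
      (TensorProduct.congr α α).toLinearMap = R.braidEnd A ∘ₗ f' := by
    refine LinearMap.ext fun w => (LinearEquiv.symm_apply_eq _).2 ?_
    rw [← hN'] at hconj
    exact LinearMap.congr_fun hconj w
  refine ⟨α, fun x u => ?_, f', ⟨fun x y u v h => ?_, fun x y u v β γ => ?_⟩, ?_,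
    fun p q => ?_, hα⟩
  · have h : α (Finsupp.single x 1) = Finsupp.single x 1 + N (Finsupp.single x 1) :=
      LinearMap.congr_fun hN' _
    rw [h, Finsupp.add_apply, Finsupp.single_apply, add_sub_cancel_left]
    exact hN x u
  · exact (mat2_eq_entries f' x y u v).trans (he.1 x y u v h)
  · rw [mat2_eq_entries, mat2_eq_entries]
    exact he.2 x y u v β γ
  · have hb : Function.Bijective (R.braidEnd A ∘ₗ f') := by
      rw [← hα]
      exact (TensorProduct.congr α α).symm.bijective.comp
        (((R.braid A).bijective.comp hfbij).comp (TensorProduct.congr α α).bijective)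
    exact (Function.Bijective.of_comp_iff' (R.braid A).bijective f').1 hb
  · exact mat2_sub_ite f' p.1 p.2 q.1 q.2 ▸ hJ p.1 p.2 q.1 q.2

end
end

section
/- Let Q be a rack, A a commutative ring, and n ≥ 1. For every A-linear map f: AQ^n → AQ^n one has d_i(d_j f) = d_{j+1}(d_i f) for all 0 ≤ i ≤ j ≤ n, and consequently d(d f) = 0, where d f = Σ_{i=0}^{n}(−1)^i d_i f and d(d f) = Σ_{i=0}^{n+1}(−1)^i d_i(d f). -/
open TensorProduct

noncomputable section

namespace YBRack

variable {Q : Type*} {A : Type*} [CommRing A]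

/-- Iterated rack action by the elements of a list: `x ^ (z₁ z₂ ⋯ z_k)`. -/
def actList (R : YBRack Q) (x : Q) (l : List Q) : Q := l.foldl R.act x

open scoped Classical in
/-- The `i`-th partial coboundary operator `d_i` on matrices of `n`-cochains
(indices `0, …, n` correspond to the paper's `x_0, …, x_n`). -/
def dPart (R : YBRack Q) {n : ℕ} (f : (Fin n → Q) → (Fin n → Q) → A) (i : Fin (n+1))
    (x y : Fin (n+1) → Q) : A :=
  f (fun j => x (i.succAbove j)) (fun j => y (i.succAbove j)) *
      (if R.actList (x i) ((List.ofFn x).drop ((i : ℕ)+1))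
          = R.actList (y i) ((List.ofFn y).drop ((i : ℕ)+1)) then 1 else 0)
  - f (fun j => if (j : ℕ) < (i : ℕ) then R.act (x (i.succAbove j)) (x i) else x (i.succAbove j))
      (fun j => if (j : ℕ) < (i : ℕ) then R.act (y (i.succAbove j)) (y i) else y (i.succAbove j)) *
      (if x i = y i then 1 else 0)

/-- The full coboundary operator `d = Σ_{i=0}^{n} (-1)^i d_i`. -/
def dSum (R : YBRack Q) {n : ℕ} (f : (Fin n → Q) → (Fin n → Q) → A)
    (x y : Fin (n+1) → Q) : A :=
  ∑ i : Fin (n+1), (-1 : A) ^ (i : ℕ) * R.dPart f i x y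

/-- A matrix is quasi-diagonal if its entry vanishes as soon as some pair of
indices is not behaviourally equivalent. -/
def QuasiDiagonal (R : YBRack Q) {n : ℕ} (f : (Fin n → Q) → (Fin n → Q) → A) : Prop :=
  ∀ x y : Fin n → Q, (∃ i : Fin n, ¬ R.BEquiv (x i) (y i)) → f x y = 0

/-- A matrix is fully equivariant if it is invariant under the coordinatewise
action of `Inn(Q)^n`. -/
def FullyEquivariant (R : YBRack Q) {n : ℕ} (f : (Fin n → Q) → (Fin n → Q) → A) : Prop :=
  ∀ (x y : Fin n → Q) (α : Fin n → R.Inn),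
    f (fun i => (α i : Equiv.Perm Q) (x i)) (fun i => (α i : Equiv.Perm Q) (y i)) = f x y

end YBRack

namespace YBRack

/-- The face map deleting the `i`-th entry of a tuple. -/
def delFace {Q : Type*} {n : ℕ} (i : Fin (n+1)) (x : Fin (n+1) → Q) : Fin n → Q :=
  fun j => x (i.succAbove j)

/-- The face map deleting the `i`-th entry of a tuple after letting it act on all
preceding entries. -/
def actFace {Q : Type*} (R : YBRack Q) {n : ℕ} (i : Fin (n+1)) (x : Fin (n+1) → Q) :
    Fin n → Q :=
  fun j => if (j : ℕ) < (i : ℕ) then R.act (x (i.succAbove j)) (x i) else x (i.succAbove j)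

/-- The `i`-th entry of a tuple, acted upon by all subsequent entries. -/
def actTail {Q : Type*} (R : YBRack Q) {n : ℕ} (i : Fin (n+1)) (x : Fin (n+1) → Q) : Q :=
  R.actList (x i) ((List.ofFn x).drop ((i : ℕ)+1))

section

variable {Q : Type*} (R : YBRack Q)

open scoped Classical in
theorem dPart_eq {A : Type*} [CommRing A] {n : ℕ} (f : (Fin n → Q) → (Fin n → Q) → A)
    (i : Fin (n+1)) (x y : Fin (n+1) → Q) :
    R.dPart f i x y =
      f (delFace i x) (delFace i y) * (if R.actTail i x = R.actTail i y then 1 else 0)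
        - f (R.actFace i x) (R.actFace i y) * (if x i = y i then 1 else 0) := rfl

theorem act_left_inj_s13 {a b c : Q} : R.act a c = R.act b c ↔ a = b :=
  (R.act_bijective c).injective.eq_iff

theorem actList_append (a : Q) (l l' : List Q) :
    R.actList a (l ++ l') = R.actList (R.actList a l) l' :=
  List.foldl_append

theorem actList_act (a b : Q) (l : List Q) :
    R.actList (R.act a b) l = R.act (R.actList a l) (R.actList b l) := by
  induction l generalizing a b with
  | nil => rfl
  | cons c l ih =>
    change R.actList (R.act (R.act a b) c) l = _
    rw [R.self_distrib, ih]
    rfl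

theorem actList_append_cons (a b : Q) (l l' : List Q) :
    R.actList a (l ++ b :: l') = R.act (R.actList a (l ++ l')) (R.actList b l') := by
  rw [actList_append, actList_append, ← actList_act]
  rfl

theorem actList_act_map (a b : Q) (l : List Q) :
    R.actList (R.act a b) (l.map (R.act · b)) = R.act (R.actList a l) b := by
  induction l generalizing a with
  | nil => rfl
  | cons c l ih =>
    change R.actList (R.act (R.act a b) (R.act c b)) (l.map (R.act · b)) = _
    rw [← R.self_distrib, ih]
    rfl

theorem succAbove_val {n : ℕ} (i : Fin (n+1)) (k : Fin n) :
    (i.succAbove k : ℕ) = if (k : ℕ) < i then (k : ℕ) else k + 1 := by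
  grind [Fin.succAbove, Fin.lt_def]

variable {n : ℕ} {i j : Fin (n+1)}

theorem castSucc_succAbove_succAbove (h : i ≤ j) (k : Fin n) :
    i.castSucc.succAbove (j.succAbove k) = j.succ.succAbove (i.succAbove k) := by
  have h : (i : ℕ) ≤ j := h
  apply Fin.ext
  simp only [succAbove_val, Fin.val_castSucc, Fin.val_succ]
  grind

theorem castSucc_succAbove_of_le (h : i ≤ j) : i.castSucc.succAbove j = j.succ :=
  Fin.succAbove_of_le_castSucc _ _ h

theorem succ_succAbove_of_le (h : i ≤ j) : j.succ.succAbove i = i.castSucc :=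
  Fin.succAbove_of_castSucc_lt _ _ (Fin.castSucc_lt_succ_iff.2 h)

variable (x : Fin (n+2) → Q)

theorem delFace_delFace (h : i ≤ j) :
    delFace j (delFace i.castSucc x) = delFace i (delFace j.succ x) := by
  funext k
  simp only [delFace, castSucc_succAbove_succAbove h]

theorem actFace_delFace (h : i ≤ j) :
    R.actFace j (delFace i.castSucc x) = delFace i (R.actFace j.succ x) := by
  funext k
  have h' : (i : ℕ) ≤ j := h
  simp only [delFace, actFace, castSucc_succAbove_succAbove h, castSucc_succAbove_of_le h,
    succAbove_val, Fin.val_succ]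
  grind

theorem delFace_actFace (h : i ≤ j) :
    delFace j (R.actFace i.castSucc x) = R.actFace i (delFace j.succ x) := by
  funext k
  have h' : (i : ℕ) ≤ j := h
  simp only [delFace, actFace, castSucc_succAbove_succAbove h, succ_succAbove_of_le h,
    succAbove_val, Fin.val_castSucc]
  grind

theorem actFace_castSucc_apply (h : i ≤ j) : R.actFace i.castSucc x j = x j.succ := by
  have h' : ¬ (j : ℕ) < i := not_lt.2 h
  simp [actFace, castSucc_succAbove_of_le h, h']

theorem actFace_succ_apply (h : i ≤ j) :
    R.actFace j.succ x i = R.act (x i.castSucc) (x j.succ) := by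
  have h' : (i : ℕ) < j + 1 := Nat.lt_succ_of_le h
  simp [actFace, succ_succAbove_of_le h, h']

theorem actFace_actFace (h : i ≤ j) :
    R.actFace j (R.actFace i.castSucc x) = R.actFace i (R.actFace j.succ x) := by
  funext k
  have h' : (i : ℕ) ≤ j := h
  rw [actFace, actFace_castSucc_apply R x h, actFace.eq_def R i, actFace_succ_apply R x h]
  simp only [actFace, castSucc_succAbove_succAbove h, succAbove_val, Fin.val_castSucc,
    Fin.val_succ]
  grind [R.self_distrib]

theorem drop_ofFn_eq_append (h : i ≤ j) :
    (List.ofFn x).drop (i+1) =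
      ((List.ofFn x).drop (i+1)).take (j-i) ++ x j.succ :: (List.ofFn x).drop (j+2) := by
  have h' : (i : ℕ) ≤ j := h
  have hj : (i : ℕ) + 1 + (j - i) = j + 1 := by omega
  conv_lhs => rw [← List.take_append_drop (j-i) ((List.ofFn x).drop (i+1))]
  rw [List.drop_drop, hj, List.drop_eq_getElem_cons (i := j + 1) (by simp; omega),
    List.getElem_ofFn]
  rfl

theorem drop_ofFn_delFace (h : i ≤ j) :
    (List.ofFn (delFace j.succ x)).drop (i+1) =
      ((List.ofFn x).drop (i+1)).take (j-i) ++ (List.ofFn x).drop (j+2) := by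
  have h' : (i : ℕ) ≤ j := h
  refine List.ext_getElem (by simp; omega) fun k hk _ => ?_
  simp only [List.getElem_append, List.getElem_drop, List.getElem_take, List.getElem_ofFn,
    delFace, List.length_take, List.length_drop, List.length_ofFn] at hk ⊢
  split_ifs <;> congr 1 <;> apply Fin.ext <;> simp only [succAbove_val, Fin.val_succ] <;>
    split_ifs <;> omega

theorem drop_ofFn_actFace (h : i ≤ j) :
    (List.ofFn (R.actFace j.succ x)).drop (i+1) =
      (((List.ofFn x).drop (i+1)).take (j-i)).map (R.act · (x j.succ)) ++
        (List.ofFn x).drop (j+2) := by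
  have h' : (i : ℕ) ≤ j := h
  refine List.ext_getElem (by simp; omega) fun k hk _ => ?_
  simp only [List.getElem_append, List.getElem_drop, List.getElem_take, List.getElem_ofFn,
    List.getElem_map, List.length_map, actFace, List.length_take, List.length_drop,
    List.length_ofFn, Fin.val_succ] at hk ⊢
  split_ifs
  any_goals omega
  all_goals
    congr 2
    apply Fin.ext
    simp only [succAbove_val, Fin.val_succ]
    split_ifs
    omega

theorem drop_ofFn_castSucc (h : i ≤ j) (z : Fin (n+1) → Q)
    (hz : ∀ k, i ≤ k → z k = x k.succ) :
    (List.ofFn z).drop (j+1) = (List.ofFn x).drop (j+2) := by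
  have h' : (i : ℕ) ≤ j := h
  refine List.ext_getElem (by simp) fun k hk _ => ?_
  simp only [List.getElem_drop, List.getElem_ofFn]
  rw [hz _ (Fin.le_def.2 (by simp; omega))]
  congr 1
  apply Fin.ext
  simp
  omega

theorem actTail_castSucc (h : i ≤ j) (z : Fin (n+1) → Q)
    (hz : ∀ k, i ≤ k → z k = x k.succ) :
    R.actTail j z = R.actTail j.succ x := by
  rw [actTail, actTail, drop_ofFn_castSucc x h z hz, hz j h]
  rfl

theorem actTail_delFace_castSucc (h : i ≤ j) :
    R.actTail j (delFace i.castSucc x) = R.actTail j.succ x :=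
  R.actTail_castSucc x h _ fun _ hk => by rw [delFace, castSucc_succAbove_of_le hk]

theorem actTail_actFace_castSucc (h : i ≤ j) :
    R.actTail j (R.actFace i.castSucc x) = R.actTail j.succ x :=
  R.actTail_castSucc x h _ fun _ hk => R.actFace_castSucc_apply x hk

theorem actTail_eq_act_actTail_delFace (h : i ≤ j) :
    R.actTail i.castSucc x = R.act (R.actTail i (delFace j.succ x)) (R.actTail j.succ x) := by
  simp only [actTail, Fin.val_castSucc, Fin.val_succ]
  rw [drop_ofFn_eq_append x h, actList_append_cons, drop_ofFn_delFace x h, delFace,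
    succ_succAbove_of_le h]

theorem actTail_actFace_succ (h : i ≤ j) :
    R.actTail i (R.actFace j.succ x) = R.actTail i.castSucc x := by
  simp only [actTail, Fin.val_castSucc]
  rw [drop_ofFn_eq_append x h, drop_ofFn_actFace R x h, actFace_succ_apply R x h,
    actList_append, actList_act_map, actList_append]
  rfl

theorem dPart_dPart {A : Type*} [CommRing A] (f : (Fin n → Q) → (Fin n → Q) → A) (h : i ≤ j)
    (x y : Fin (n+2) → Q) :
    R.dPart (R.dPart f j) i.castSucc x y = R.dPart (R.dPart f i) j.succ x y := by
  classical
  simp only [dPart_eq, delFace_delFace _ h, actFace_delFace R _ h, delFace_actFace R _ h,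
    actFace_actFace R _ h, actTail_delFace_castSucc R _ h, actTail_actFace_castSucc R _ h,
    actTail_actFace_succ R _ h, actFace_castSucc_apply R _ h, actFace_succ_apply R _ h,
    actTail_eq_act_actTail_delFace R _ h]
  have hd (z : Fin (n+2) → Q) : delFace i.castSucc z j = z j.succ := by
    rw [delFace, castSucc_succAbove_of_le h]
  have hd' (z : Fin (n+2) → Q) : delFace j.succ z i = z i.castSucc := by
    rw [delFace, succ_succAbove_of_le h]
  rw [hd, hd, hd', hd']
  by_cases hT : R.actTail j.succ x = R.actTail j.succ y <;>
  by_cases hE : x j.succ = y j.succ <;>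
  simp only [hT, hE, act_left_inj_s13, if_true, if_false] <;> ring

theorem dPart_dSum {A : Type*} [CommRing A] (f : (Fin n → Q) → (Fin n → Q) → A)
    (i : Fin (n+2)) (x y : Fin (n+2) → Q) :
    R.dPart (R.dSum f) i x y =
      ∑ j : Fin (n+1), (-1 : A) ^ (j : ℕ) * R.dPart (R.dPart f j) i x y := by
  classical
  simp only [R.dPart_eq _ i, dSum, Finset.sum_mul, ← Finset.sum_sub_distrib, mul_sub, mul_assoc]

end

end YBRack

/-- An alternating double sum whose terms satisfy the simplicial identities vanishes. -/
theorem sum_neg_one_pow_mul_eq_zero_of_simplicial {A : Type*} [CommRing A] {n : ℕ}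
    (D : Fin (n+2) → Fin (n+1) → A)
    (hD : ∀ i j : Fin (n+1), i ≤ j → D i.castSucc j = D j.succ i) :
    ∑ i : Fin (n+2), ∑ j : Fin (n+1), (-1 : A) ^ (i : ℕ) * ((-1 : A) ^ (j : ℕ) * D i j) = 0 := by
  rw [← Finset.sum_product', Finset.univ_product_univ,
    ← Finset.sum_filter_add_sum_filter_not _
      (fun p : Fin (n+2) × Fin (n+1) => (p.1 : ℕ) ≤ p.2),
    ← eq_neg_iff_add_eq_zero, ← Finset.sum_neg_distrib]
  refine Finset.sum_bij'
    (fun p hp => (p.2.succ, p.1.castLT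
      (lt_of_le_of_lt (Finset.mem_filter.mp hp).2 p.2.is_lt)))
    (fun p hp => (p.2.castSucc, p.1.pred (by
      rintro h
      simp [h] at hp))) ?_ ?_ ?_ ?_ ?_
  · rintro ⟨i, j⟩ hp
    simp at hp ⊢
    omega
  · rintro ⟨i, j⟩ hp
    simp at hp ⊢
    omega
  · rintro ⟨i, j⟩ hp
    simp
  · rintro ⟨i, j⟩ hp
    simp
  · rintro ⟨i, j⟩ hp
    have hij : (i : ℕ) ≤ j := (Finset.mem_filter.mp hp).2
    have := hD (i.castLT (by omega)) j hij
    rw [Fin.castSucc_castLT] at this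
    simp only [this, Fin.val_succ, Fin.val_castLT]
    ring

/-- (Simplicial identities and `d ∘ d = 0`.) For all
`0 ≤ i ≤ j ≤ n` one has `d_i (d_j f) = d_{j+1} (d_i f)`, and consequently
`d (d f) = 0`. -/
theorem coboundary_squared_zero
    {A Q : Type*} [CommRing A] (R : YBRack Q) {n : ℕ} (hn : 1 ≤ n)
    (f : (Fin n → Q) → (Fin n → Q) → A) :
    (∀ i j : Fin (n+1), i ≤ j → ∀ x y : Fin (n+2) → Q,
      R.dPart (R.dPart f j) i.castSucc x y = R.dPart (R.dPart f i) j.succ x y) ∧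
    (∀ x y : Fin (n+2) → Q, R.dSum (R.dSum f) x y = 0) := by
  refine ⟨fun i j h x y => R.dPart_dPart f h x y, fun x y => ?_⟩
  rw [YBRack.dSum]
  simp only [YBRack.dPart_dSum, Finset.mul_sum]
  exact sum_neg_one_pow_mul_eq_zero_of_simplicial
    (fun i j => R.dPart (R.dPart f j) i x y) fun i j h => R.dPart_dPart f h x y

end
end
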